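/- Let q be a power of 2 and n ≥ 1. The number of orbits of O^-_{2n}(𝐅_q) acting by conjugation on the set of nilpotent elements of 𝔬^-_{2n}(𝐅_q) equals (1/2)p₂(n) if n is odd, and equals (1/2)(p₂(n) − p(n/2)) if n is even. -/

import Mathlib

open Module Finset

/-- The radical `V^⊥ = {v | ⟨v,w⟩ = 0 for all w}` of the polar form of `Q`. -/
def QuadraticForm.polarRadical {F V : Type*} [Field F] [AddCommGroup V] [Module F V]
    (Q : QuadraticForm F V) : Submodule F V :=
  LinearMap.ker (QuadraticMap.polarBilin Q)

/-- A quadratic space `(V, Q)` (in characteristic 2) is non-degenerate if `V ≠ 0`,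
`dim V^⊥ ≤ 1` and `Q(v) ≠ 0` for every nonzero `v ∈ V^⊥`. -/
def QuadraticForm.IsNondegenerateFormSpace {F V : Type*} [Field F] [AddCommGroup V] [Module F V]
    (Q : QuadraticForm F V) : Prop :=
  Nontrivial V ∧ Module.finrank F Q.polarRadical ≤ 1 ∧
    ∀ v ∈ Q.polarRadical, v ≠ 0 → Q v ≠ 0

/-- Membership in the orthogonal Lie algebra
`𝔬(V) = {x ∈ End(V) | ⟨xv, v⟩ = 0 ∀ v, tr x = 0}`. -/
def QuadraticForm.mem_oLie {F V : Type*} [Field F] [AddCommGroup V] [Module F V]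
    (Q : QuadraticForm F V) (x : Module.End F V) : Prop :=
  (∀ v : V, QuadraticMap.polar Q (x v) v = 0) ∧ LinearMap.trace F V x = 0

/-- Two endomorphisms of `V` are conjugate under the orthogonal group
`O(V) = {g ∈ GL(V) | Q(gv) = Q(v) ∀ v}`. -/
def QuadraticForm.OConj {F V : Type*} [Field F] [AddCommGroup V] [Module F V]
    (Q : QuadraticForm F V) (x y : Module.End F V) : Prop :=
  ∃ g : V ≃ₗ[F] V, (∀ v : V, Q (g v) = Q v) ∧
    y = g.toLinearMap ∘ₗ x ∘ₗ g.symm.toLinearMap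

/-- The number of orbits of `O(V)` acting by conjugation on the set of nilpotent
elements of `𝔬(V)`. -/
noncomputable def QuadraticForm.numNilpotentOOrbits {F V : Type*} [Field F] [AddCommGroup V]
    [Module F V] (Q : QuadraticForm F V) : ℕ :=
  Nat.card (Quot fun x y : {x : Module.End F V // Q.mem_oLie x ∧ IsNilpotent x} =>
    Q.OConj x.1 y.1)

/-- `p(k)`, the number of partitions of `k`. -/
def numPartitions (k : ℕ) : ℕ := Fintype.card (Nat.Partition k)

/-- `p₂(n)`, the number of ordered pairs `(α, β)` of partitions with `|α| + |β| = n`. -/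
def numPartitionPairs (n : ℕ) : ℕ :=
  ∑ k ∈ Finset.range (n + 1), numPartitions k * numPartitions (n - k)

/-- `(V, Q)` contains a totally singular subspace of dimension `d`
(so the Witt index of `Q` is at least `d`). -/
def QuadraticForm.HasTotallySingularSubspace {F V : Type*} [Field F] [AddCommGroup V]
    [Module F V] (Q : QuadraticForm F V) (d : ℕ) : Prop :=
  ∃ W : Submodule F V, Module.finrank F W = d ∧ ∀ w ∈ W, Q w = 0


set_option linter.unusedSectionVars false


/-- `(V,b,x)`: symplectic space with nilpotent `x` such that `b(x·,·)` is alternating. -/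
structure SN {F V : Type*} [Field F] [AddCommGroup V] [Module F V]
    (b : LinearMap.BilinForm F V) (x : Module.End F V) : Prop where
  alt : ∀ v, b v v = 0
  nd : ∀ v, (∀ w, b v w = 0) → v = 0
  sa : ∀ v, b (x v) v = 0
  nil : IsNilpotent x

/-- the centralizer of `x` in the symplectic group. -/
def Gx {F V : Type*} [Field F] [AddCommGroup V] [Module F V]
    (b : LinearMap.BilinForm F V) (x : Module.End F V) : Subgroup (V ≃ₗ[F] V) where
  carrier := {g | (∀ u w, b (g u) (g w) = b u w) ∧ ∀ u, g (x u) = x (g u)}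
  mul_mem' := by
    rintro g h ⟨h1, h2⟩ ⟨h3, h4⟩
    refine ⟨fun u w => ?_, fun u => ?_⟩
    · simp [LinearEquiv.mul_apply, h1, h3]
    · simp [LinearEquiv.mul_apply, h2, h4]
  one_mem' := by simp
  inv_mem' := by
    rintro g ⟨h1, h2⟩
    have hg : ∀ u, g (g⁻¹ u) = u := fun u => by
      rw [← LinearEquiv.mul_apply, mul_inv_cancel]; rfl
    refine ⟨fun u w => ?_, fun u => ?_⟩
    · rw [← h1, hg, hg]
    · apply g.injective
      rw [h2, hg, hg]

section basic
variable {F V : Type*} [Field F] [CharP F 2] [AddCommGroup V] [Module F V]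
  {b : LinearMap.BilinForm F V} {x : Module.End F V}

theorem char2_add (V : Type*) (F : Type*) [Field F] [CharP F 2] [AddCommGroup V] [Module F V]
    (v : V) : v + v = 0 := by
  have : (2 : F) • v = 0 := by
    rw [CharTwo.two_eq_zero, zero_smul]
  rwa [two_smul] at this

theorem char2_neg (V : Type*) (F : Type*) [Field F] [CharP F 2] [AddCommGroup V] [Module F V]
    (v : V) : -v = v := by
  rw [neg_eq_iff_add_eq_zero]; exact char2_add V F v

theorem SN.symm (h : SN b x) (v w : V) : b v w = b w v := by
  have := h.alt (v + w)
  simp only [map_add, LinearMap.add_apply, h.alt, zero_add, add_zero] at this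
  rw [← sub_eq_zero, CharTwo.sub_eq_add, add_comm]; exact this

theorem SN.adj (h : SN b x) (v w : V) : b (x v) w = b v (x w) := by
  have := h.sa (v + w)
  simp only [map_add, LinearMap.add_apply, h.sa, zero_add, add_zero] at this
  rw [h.symm v, ← sub_eq_zero, CharTwo.sub_eq_add, add_comm]; exact this

theorem SN.adj_pow (h : SN b x) (k : ℕ) (v w : V) : b ((x ^ k) v) w = b v ((x ^ k) w) := by
  induction k generalizing v w with
  | zero => simp
  | succ k ih => rw [pow_succ, Module.End.mul_apply, ih, h.adj, ← Module.End.mul_apply, ← pow_succ', pow_succ]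

theorem SN.adj_poly (h : SN b x) (p : Polynomial F) (v w : V) :
    b (Polynomial.aeval x p v) w = b v (Polynomial.aeval x p w) := by
  induction p using Polynomial.induction_on' with
  | add p q hp hq => simp [hp, hq]
  | monomial n a => simp [Polynomial.aeval_monomial, h.adj_pow, Algebra.algebraMap_eq_smul_one]

theorem SN.pow_self (h : SN b x) (k : ℕ) (v : V) : b ((x ^ k) v) v = 0 := by
  obtain ⟨m, hm | hm⟩ := Nat.even_or_odd' k
  · rw [hm, two_mul, pow_add, Module.End.mul_apply, h.adj_pow, h.alt]
  · rw [hm, two_mul, add_right_comm, pow_add, Module.End.mul_apply, pow_succ', Module.End.mul_apply,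
      ← Module.End.mul_apply, ]
    have : (x * x ^ m) ((x ^ m) v) = (x ^ m) (x ((x ^ m) v)) := by
      rw [← Module.End.mul_apply (x ^ m) x, ← pow_succ, ← pow_succ', pow_succ]
    rw [this, h.adj_pow, h.sa]

/-- the residue operator `u ↦ ∑ b(x^(L-1-k) u, z) x^k z`. -/
noncomputable def Dop (b : LinearMap.BilinForm F V) (x : Module.End F V) (L : ℕ) (z : V) :
    Module.End F V :=
  ∑ k ∈ range L, (b.flip z ∘ₗ (x ^ (L - 1 - k))).smulRight ((x ^ k) z)

theorem Dop_apply (L : ℕ) (z u : V) :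
    Dop b x L z u = ∑ k ∈ range L, b ((x ^ (L - 1 - k)) u) z • (x ^ k) z := by
  simp [Dop, LinearMap.sum_apply]

theorem SN.Dop_comm (h : SN b x) (L : ℕ) (z u : V) (hz : (x ^ L) z = 0) :
    Dop b x L z (x u) = x (Dop b x L z u) := by
  rw [Dop_apply, Dop_apply, map_sum]
  cases L with
  | zero => simp
  | succ L =>
    rw [Finset.sum_range_succ', Finset.sum_range_succ]
    have e1 : b ((x ^ (L + 1 - 1 - 0)) (x u)) z = 0 := by
      rw [← Module.End.mul_apply, ← pow_succ, h.adj_pow]; simp [hz]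
    have e2 : x ((x ^ L) z) = 0 := by
      rw [← Module.End.mul_apply, ← pow_succ', hz]
    rw [e1, zero_smul, add_zero, map_smul, e2, smul_zero, add_zero]
    apply Finset.sum_congr rfl
    intro k hk
    have hk' := Finset.mem_range.1 hk
    rw [map_smul, ← Module.End.mul_apply x, ← pow_succ', ← Module.End.mul_apply _ x, ← pow_succ]
    congr 5
    omega

theorem SN.Dop_adj (h : SN b x) (L : ℕ) (z u w : V) :
    b (Dop b x L z u) w = b u (Dop b x L z w) := by
  rw [Dop_apply, Dop_apply, map_sum, map_sum, LinearMap.sum_apply]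
  rw [← Finset.sum_range_reflect]
  apply Finset.sum_congr rfl
  intro k hk
  have hk' := Finset.mem_range.1 hk
  have : L - 1 - (L - 1 - k) = k := by omega
  rw [this]
  simp only [map_smul, LinearMap.smul_apply, smul_eq_mul]
  rw [h.adj_pow k u z, h.adj_pow _ z w, h.symm z, mul_comm]

theorem SN.Dop_sq (h : SN b x) (L : ℕ) (z u : V) :
    Dop b x L z (Dop b x L z u) = 0 := by
  rw [Dop_apply]
  apply Finset.sum_eq_zero
  intro k _
  rw [Dop_apply, map_sum, map_sum, LinearMap.sum_apply, Finset.sum_eq_zero, zero_smul]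
  intro j _
  rw [map_smul, map_smul, LinearMap.smul_apply, ← Module.End.mul_apply, ← pow_add, h.pow_self,
    smul_zero]

theorem comm_aeval {D : Module.End F V} (hD : ∀ u, D (x u) = x (D u)) (p : Polynomial F) (u : V) :
    D (Polynomial.aeval x p u) = Polynomial.aeval x p (D u) := by
  have h1 : Commute D x := by
    ext u; simp [hD]
  have h2 : Commute D (Polynomial.aeval x p) := by
    induction p using Polynomial.induction_on' with
    | add p q hp hq => simpa using hp.add_right hq
    | monomial n a =>
      rw [Polynomial.aeval_monomial]
      exact (Algebra.commute_algebraMap_right a D).mul_right (h1.pow_right n)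
  exact LinearMap.congr_fun h2.eq u

/-- One-step move by a transvection. -/
theorem SN.step [FiniteDimensional F V] (h : SN b x) (L : ℕ) (v z : V) (hL : 1 ≤ L)
    (hz : (x ^ L) z = 0)
    (hv : b v ((x ^ (L - 1)) z) ≠ 0) : ∃ g ∈ Gx b x, g v = v + z := by
  set p : Polynomial F := ∑ k ∈ range L,
    Polynomial.monomial k (b ((x ^ (L - 1 - k)) v) z) with hp
  have hDv : Dop b x L z v = Polynomial.aeval x p z := by
    rw [Dop_apply, hp, map_sum, LinearMap.sum_apply]
    apply Finset.sum_congr rfl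
    intro k _
    simp [Polynomial.aeval_monomial, Algebra.algebraMap_eq_smul_one]
  have hp0 : p.coeff 0 ≠ 0 := by
    rw [hp, Polynomial.finsetSum_coeff, Finset.sum_eq_single 0]
    · simpa [h.adj_pow] using hv
    · intro k _ hk; simp [Polynomial.coeff_monomial, hk]
    · intro h0; simp at h0; omega
  have hcop : IsCoprime p (Polynomial.X ^ L) := by
    apply IsCoprime.pow_right
    rw [isCoprime_comm]
    rw [Polynomial.irreducible_X.coprime_iff_not_dvd, Polynomial.X_dvd_iff]
    exact hp0
  obtain ⟨c, d, hcd⟩ := hcop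
  set S : Module.End F V := Polynomial.aeval x c * Dop b x L z with hS
  have hSv : S v = z := by
    have := congrArg (fun q => Polynomial.aeval x q z) hcd
    simp only [map_add, map_mul, LinearMap.add_apply, Module.End.mul_apply, map_pow,
      Polynomial.aeval_X, hz, map_zero, add_zero, map_one, Module.End.one_apply] at this
    rw [hS, Module.End.mul_apply, hDv, this]
  have hDc := fun u => h.Dop_comm L z u hz
  have hSc : ∀ u, S (x u) = x (S u) := by
    intro u
    rw [hS, Module.End.mul_apply, hDc, Module.End.mul_apply]
    exact (comm_aeval (D := x) (fun _ => rfl) c _).symm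
  have hSS : ∀ u, S (S u) = 0 := by
    intro u
    rw [hS, Module.End.mul_apply, Module.End.mul_apply, comm_aeval hDc, h.Dop_sq]; simp
  have hSa : ∀ u w, b (S u) w = b u (S w) := by
    intro u w
    rw [hS, Module.End.mul_apply, Module.End.mul_apply, h.adj_poly, h.Dop_adj, comm_aeval hDc]
  have hb : ∀ u w, b (u + S u) (w + S w) = b u w := by
    intro u w
    simp only [map_add, LinearMap.add_apply, hSa, hSS, map_zero, add_zero]
    rw [add_assoc, CharTwo.add_self_eq_zero, add_zero]
  have hinv : ∀ u, (u + S u) + S (u + S u) = u := by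
    intro u
    rw [map_add, hSS, add_zero, add_assoc, char2_add V F, add_zero]
  have hI : Function.Involutive (1 + S : V →ₗ[F] V) := fun u => hinv u
  have hgu : ∀ u, LinearEquiv.ofInvolutive (1 + S : V →ₗ[F] V) hI u = u + S u := fun u => rfl
  refine ⟨LinearEquiv.ofInvolutive (1 + S : V →ₗ[F] V) hI, ⟨?_, ?_⟩, ?_⟩
  · intro u w
    rw [hgu, hgu, hb]
  · intro u
    rw [hgu, hgu, hSc, map_add]
  · rw [hgu, hSv]

end basic


section trans
variable {F V : Type*} [Field F] [CharP F 2] [AddCommGroup V] [Module F V] [FiniteDimensional F V]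
  {b : LinearMap.BilinForm F V} {x : Module.End F V}

/-- the characteristic submodule `x^j V + ker x^l`. -/
def Njl (x : Module.End F V) (j l : ℕ) : Submodule F V :=
  LinearMap.range (x ^ j) ⊔ LinearMap.ker (x ^ l)

theorem SN.isRefl (h : SN b x) : b.IsRefl := fun v w hvw => by rw [h.symm]; exact hvw

theorem SN.nondeg (h : SN b x) : b.Nondegenerate := by
  refine ⟨fun v hv => h.nd v hv, fun v hv => h.nd v fun w => ?_⟩
  rw [h.symm]; exact hv w

theorem SN.oo (h : SN b x) (W : Submodule F V) : b.orthogonal (b.orthogonal W) = W :=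
  LinearMap.BilinForm.orthogonal_orthogonal h.nondeg h.isRefl W

theorem SN.range_orth (h : SN b x) (k : ℕ) :
    b.orthogonal (LinearMap.range (x ^ k)) = LinearMap.ker (x ^ k) := by
  ext y
  rw [LinearMap.BilinForm.mem_orthogonal_iff, LinearMap.mem_ker]
  constructor
  · intro hy
    apply h.nd
    intro w
    rw [h.symm, ← h.adj_pow]
    exact hy _ ⟨w, rfl⟩
  · rintro hy _ ⟨w, rfl⟩
    show b _ _ = 0
    rw [h.adj_pow, hy, map_zero]

theorem SN.ker_orth (h : SN b x) (k : ℕ) :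
    b.orthogonal (LinearMap.ker (x ^ k)) = LinearMap.range (x ^ k) := by
  rw [← h.range_orth, h.oo]

theorem SN.exists_y (h : SN b x) (L : ℕ) (v : V) (hL : 1 ≤ L) (hv : v ∉ Njl x 1 (L - 1)) :
    ∃ y, (x ^ L) y = 0 ∧ b v ((x ^ (L - 1)) y) ≠ 0 := by
  rw [← h.oo (Njl x 1 (L - 1)), LinearMap.BilinForm.mem_orthogonal_iff] at hv
  push Not at hv
  obtain ⟨s, hs, hsv⟩ := hv
  have h1 : s ∈ LinearMap.ker (x ^ 1) := by
    rw [← h.range_orth]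
    exact LinearMap.BilinForm.orthogonal_le le_sup_left hs
  have h2 : s ∈ LinearMap.range (x ^ (L - 1)) := by
    rw [← h.ker_orth]
    exact LinearMap.BilinForm.orthogonal_le le_sup_right hs
  obtain ⟨y, rfl⟩ := h2
  refine ⟨y, ?_, ?_⟩
  · rw [LinearMap.mem_ker, ← Module.End.mul_apply, ← pow_add] at h1
    rwa [show 1 + (L - 1) = L by omega] at h1
  · rw [h.symm]; exact hsv

theorem SN.two_step (h : SN b x) (L : ℕ) (v z : V) (hL : 1 ≤ L) (hz : (x ^ L) z = 0)
    (hv : v ∉ Njl x 1 (L - 1)) (hw : v + z ∉ Njl x 1 (L - 1)) :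
    ∃ g ∈ Gx b x, g v = v + z := by
  by_cases hvz : b v ((x ^ (L - 1)) z) = 0
  swap
  · exact h.step L v z hL hz hvz
  have key : ∃ y, (x ^ L) y = 0 ∧ b v ((x ^ (L - 1)) y) ≠ 0 ∧
      b (v + z) ((x ^ (L - 1)) y) ≠ 0 := by
    obtain ⟨y1, h1, h1'⟩ := h.exists_y L v hL hv
    obtain ⟨y2, h2, h2'⟩ := h.exists_y L (v + z) hL hw
    by_cases c1 : b (v + z) ((x ^ (L - 1)) y1) = 0
    swap
    · exact ⟨y1, h1, h1', c1⟩
    by_cases c2 : b v ((x ^ (L - 1)) y2) = 0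
    swap
    · exact ⟨y2, h2, c2, h2'⟩
    refine ⟨y1 + y2, by rw [map_add, h1, h2, add_zero], ?_, ?_⟩
    · rw [map_add, map_add, c2, add_zero]; exact h1'
    · rw [map_add (x ^ (L - 1)), map_add (b (v + z)), c1, zero_add]; exact h2'
  obtain ⟨y, hy, hy1, hy2⟩ := key
  obtain ⟨g1, hg1, e1⟩ := h.step L v y hL hy hy1
  obtain ⟨g2, hg2, e2⟩ := h.step L (v + y) (z - y) hL (by rw [map_sub, hz, hy, sub_zero]) (by
    have e : b y ((x ^ (L - 1)) z) = b z ((x ^ (L - 1)) y) := by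
      rw [← h.adj_pow, h.symm]
    have e' : b y ((x ^ (L - 1)) y) = 0 := by
      rw [← h.adj_pow, h.pow_self]
    simp only [map_add, map_sub, LinearMap.add_apply] at hy2 ⊢
    rw [hvz, e, e', CharTwo.sub_eq_add, zero_add, add_zero, add_comm]
    exact hy2)
  refine ⟨g2 * g1, mul_mem hg2 hg1, ?_⟩
  rw [LinearEquiv.mul_apply, e1, e2]
  abel

theorem Gx_pow {g : V ≃ₗ[F] V} (hg : g ∈ Gx b x) (k : ℕ) (v : V) :
    g ((x ^ k) v) = (x ^ k) (g v) := by
  induction k generalizing v with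
  | zero => simp
  | succ k ih => rw [pow_succ, Module.End.mul_apply, ih, hg.2, Module.End.mul_apply]

theorem Gx_Njl' {g : V ≃ₗ[F] V} (hg : g ∈ Gx b x) (j l : ℕ) (v : V) (hv : v ∈ Njl x j l) :
    g v ∈ Njl x j l := by
  obtain ⟨_, ⟨r, rfl⟩, k, hk, rfl⟩ := Submodule.mem_sup.1 hv
  rw [map_add, Gx_pow hg]
  refine Submodule.add_mem_sup ⟨_, rfl⟩ ?_
  rw [LinearMap.mem_ker] at hk ⊢
  rw [← Gx_pow hg, hk, map_zero]

theorem Gx_Njl {g : V ≃ₗ[F] V} (hg : g ∈ Gx b x) (j l : ℕ) (v : V) :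
    g v ∈ Njl x j l ↔ v ∈ Njl x j l := by
  refine ⟨fun hv => ?_, Gx_Njl' hg j l v⟩
  have := Gx_Njl' (inv_mem hg) j l _ hv
  rwa [← LinearEquiv.mul_apply, inv_mul_cancel] at this

theorem ker_pow_mono {a c : ℕ} (h : a ≤ c) {v : V} (hv : (x ^ a) v = 0) : (x ^ c) v = 0 := by
  rw [← Nat.sub_add_cancel h, pow_add, Module.End.mul_apply, hv, map_zero]

theorem mem_Njl_succ (j l : ℕ) (v : V) : v ∈ Njl x j (l + 1) ↔ x v ∈ Njl x (j + 1) l := by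
  constructor
  · intro hv
    obtain ⟨_, ⟨r, rfl⟩, k, hk, rfl⟩ := Submodule.mem_sup.1 hv
    rw [map_add]
    refine Submodule.add_mem_sup ⟨r, ?_⟩ ?_
    · rw [pow_succ', Module.End.mul_apply]
    · rw [LinearMap.mem_ker, pow_succ, Module.End.mul_apply] at hk
      exact hk
  · intro hv
    obtain ⟨_, ⟨r, rfl⟩, k, hk, e⟩ := Submodule.mem_sup.1 hv
    have : v = (x ^ j) r + (v - (x ^ j) r) := by abel
    rw [this]
    refine Submodule.add_mem_sup ⟨r, rfl⟩ ?_
    rw [LinearMap.mem_ker, pow_succ, Module.End.mul_apply, map_sub, ← e]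
    rw [← Module.End.mul_apply x, ← pow_succ', add_sub_cancel_left]
    exact hk

theorem SN.claim (h : SN b x) (m : ℕ) (hm : x ^ m = 0) (k : ℕ) : ∀ (d : ℕ), m ≤ d + k →
    ∀ v w : V, (∀ j l, v ∈ Njl x j (l + d) ↔ w ∈ Njl x j (l + d)) →
    ∃ g ∈ Gx b x, (x ^ d) (g v - w) = 0 := by
  induction k with
  | zero =>
    intro d hd v w _
    refine ⟨1, one_mem _, ?_⟩
    rw [pow_eq_zero_of_le (show m ≤ d from hd) hm]; simp
  | succ k ih =>
    intro d hd v w hvw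
    by_cases hv : v ∈ Njl x 1 d
    · have hw : w ∈ Njl x 1 d := by simpa [hv] using hvw 1 0
      obtain ⟨_, ⟨v', rfl⟩, k1, hk1, e1⟩ := Submodule.mem_sup.1 hv
      obtain ⟨_, ⟨w', rfl⟩, k2, hk2, e2⟩ := Submodule.mem_sup.1 hw
      rw [pow_one] at e1 e2
      have tr : ∀ (u' k : V), k ∈ LinearMap.ker (x ^ d) → ∀ j l,
          (u' ∈ Njl x j (l + (d + 1)) ↔ x u' + k ∈ Njl x (j + 1) (l + d)) := by
        intro u' k hk j l
        rw [← add_assoc, mem_Njl_succ]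
        have : k ∈ Njl x (j + 1) (l + d) :=
          Submodule.mem_sup_right (ker_pow_mono (by omega) hk)
        rw [Submodule.add_mem_iff_left _ this]
      obtain ⟨g, hg, e⟩ := ih (d + 1) (by omega) v' w' (fun j l => by
        rw [tr v' k1 hk1, tr w' k2 hk2, e1, e2]; exact hvw _ _)
      refine ⟨g, hg, ?_⟩
      rw [LinearMap.mem_ker] at hk1 hk2
      rw [← e1, ← e2, map_add, hg.2]
      have : x (g v') + g k1 - (x w' + k2) = x (g v' - w') + g k1 - k2 := by
        rw [map_sub]; abel
      rw [this, map_sub, map_add, ← Gx_pow hg, hk1, hk2, map_zero, ← Module.End.mul_apply,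
        ← pow_succ, e]; simp
    · have ex : ∃ l, v ∈ Njl x 1 (l + d) := by
        refine ⟨m, Submodule.mem_sup_right ?_⟩
        rw [pow_eq_zero_of_le (by omega) hm]; simp
      classical
      set l := Nat.find ex with hl
      have hl1 : v ∈ Njl x 1 (l + d) := Nat.find_spec ex
      have hl0 : 1 ≤ l := by
        rcases Nat.eq_zero_or_pos l with h0 | h0
        · rw [h0, zero_add] at hl1; exact absurd hl1 hv
        · exact h0
      have hl2 : v ∉ Njl x 1 ((l - 1) + d) := Nat.find_min ex (by omega)
      obtain ⟨g, hg, e⟩ := ih (l + d) (by omega) v w (fun j i => by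
        rw [← add_assoc]; exact hvw _ _)
      have hgv : g v ∉ Njl x 1 ((l - 1) + d) := by rwa [Gx_Njl hg]
      have hw : w ∉ Njl x 1 ((l - 1) + d) := by rwa [← hvw]
      obtain ⟨g', hg', e'⟩ := h.two_step (l + d) (g v) (w - g v) (by omega)
        (by rw [← neg_sub, map_neg, e, neg_zero])
        (by rwa [show l + d - 1 = l - 1 + d by omega])
        (by rwa [show l + d - 1 = l - 1 + d by omega, add_sub_cancel])
      refine ⟨g' * g, mul_mem hg' hg, ?_⟩
      rw [LinearEquiv.mul_apply, e', add_sub_cancel, sub_self, map_zero]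

/-- Two vectors with the same membership in all `x^j V + ker x^l` are conjugate. -/
theorem SN.transitive (h : SN b x) (v w : V) (hvw : ∀ j l, v ∈ Njl x j l ↔ w ∈ Njl x j l) :
    ∃ g ∈ Gx b x, g v = w := by
  obtain ⟨m, hm⟩ := h.nil
  obtain ⟨g, hg, e⟩ := h.claim m hm m 0 (by omega) v w (fun j l => hvw j l)
  exact ⟨g, hg, by simpa [sub_eq_zero] using e⟩

end trans


/-- A symplectic Jordan system. -/
structure JS {F V : Type*} [Field F] [AddCommGroup V] [Module F V]
    (b : LinearMap.BilinForm F V) (x : Module.End F V) (lam : ℕ → ℕ) (e f : ℕ → V) : Prop where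
  ee : ∀ i j k l, b ((x ^ k) (e i)) ((x ^ l) (e j)) = 0
  ff : ∀ i j k l, b ((x ^ k) (f i)) ((x ^ l) (f j)) = 0
  ef : ∀ i j k l, b ((x ^ k) (e i)) ((x ^ l) (f j)) = if i = j ∧ k + l + 1 = lam i then 1 else 0
  xe : ∀ i, (x ^ (lam i)) (e i) = 0
  xf : ∀ i, (x ^ (lam i)) (f i) = 0

theorem SN.exists_pair {F V : Type*} [Field F] [CharP F 2] [AddCommGroup V] [Module F V]
    [FiniteDimensional F V] [Nontrivial V]
    {b : LinearMap.BilinForm F V} {x : Module.End F V} (h : SN b x) :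
    ∃ (m : ℕ) (e f : V), 1 ≤ m ∧ x ^ m = 0 ∧
      ∀ k, b ((x ^ k) e) f = if k + 1 = m then 1 else 0 := by
  classical
  obtain ⟨m, hm1, hm2⟩ : ∃ m, x ^ m = 0 ∧ ∀ k < m, x ^ k ≠ 0 :=
    ⟨Nat.find h.nil, Nat.find_spec h.nil, fun k hk => Nat.find_min h.nil hk⟩
  have hm0 : 1 ≤ m := by
    rcases Nat.eq_zero_or_pos m with h0 | h0
    · rw [h0, pow_zero] at hm1; exact absurd hm1 one_ne_zero
    · exact h0
  obtain ⟨e, he⟩ : ∃ e, (x ^ (m - 1)) e ≠ 0 := by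
    by_contra hc
    push Not at hc
    exact hm2 (m - 1) (by omega) (LinearMap.ext hc)
  obtain ⟨f', hf'⟩ : ∃ f, b ((x ^ (m - 1)) e) f ≠ 0 := by
    by_contra hc
    push Not at hc
    exact he (h.nd _ hc)
  set p : Polynomial F := ∑ k ∈ range m,
    Polynomial.monomial k (b ((x ^ (m - 1 - k)) e) f') with hp
  have hpc : ∀ j, p.coeff j = if j < m then b ((x ^ (m - 1 - j)) e) f' else 0 := by
    intro j
    rw [hp, Polynomial.finsetSum_coeff]
    simp [Polynomial.coeff_monomial]
  have hrho : ∀ q : Polynomial F, b (Polynomial.aeval x q e) f' = (q * p).coeff (m - 1) := by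
    intro q
    induction q using Polynomial.induction_on' with
    | add p q hp hq => simp [hp, hq, add_mul]
    | monomial n a =>
      rw [Polynomial.aeval_monomial, ← Polynomial.C_mul_X_pow_eq_monomial, mul_assoc,
        Polynomial.coeff_C_mul, Polynomial.coeff_X_pow_mul', hpc]
      by_cases hn : n ≤ m - 1
      · rw [if_pos hn, if_pos (by omega), show m - 1 - (m - 1 - n) = n by omega]
        simp [Algebra.algebraMap_eq_smul_one]
      · rw [if_neg hn, pow_eq_zero_of_le (by omega) hm1]; simp
  have hp0 : p.coeff 0 ≠ 0 := by
    rw [hpc, if_pos (by omega)]; exact hf'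
  have hcop : IsCoprime p (Polynomial.X ^ m) := by
    apply IsCoprime.pow_right
    rw [isCoprime_comm]
    rw [Polynomial.irreducible_X.coprime_iff_not_dvd, Polynomial.X_dvd_iff]
    exact hp0
  obtain ⟨c, d, hcd⟩ := hcop
  refine ⟨m, e, Polynomial.aeval x c f', hm0, hm1, fun k => ?_⟩
  rw [← h.adj_poly]
  have : Polynomial.aeval x c ((x ^ k) e) = Polynomial.aeval x (Polynomial.X ^ k * c) e := by
    rw [mul_comm]; simp
  rw [this, hrho, mul_assoc]
  have hcp : c * p = 1 - d * Polynomial.X ^ m := by rw [← hcd]; ring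
  rw [hcp, mul_sub, mul_one, Polynomial.coeff_sub, ← mul_assoc, Polynomial.coeff_mul_X_pow',
    if_neg (by omega), sub_zero, Polynomial.coeff_X_pow]
  congr 1
  apply propext
  omega

universe u v

theorem SN.exists_JS {F : Type u} [Field F] [CharP F 2] (N : ℕ) :
    ∀ (V : Type v) [AddCommGroup V] [Module F V] [FiniteDimensional F V]
    (b : LinearMap.BilinForm F V) (x : Module.End F V), SN b x → finrank F V = N →
    ∃ (r : ℕ) (lam : ℕ → ℕ) (e f : ℕ → V), Antitone lam ∧ (∀ i, r ≤ i → lam i = 0) ∧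
      (∀ i < r, 1 ≤ lam i) ∧ N = 2 * ∑ i ∈ range r, lam i ∧ JS b x lam e f := by
  induction N using Nat.strong_induction_on with
  | _ N ih =>
  intro V _ _ _ b x h hN
  rcases subsingleton_or_nontrivial V with hV | hV
  · refine ⟨0, fun _ => 0, fun _ => 0, fun _ => 0, fun _ _ _ => le_rfl, fun _ _ => rfl,
      fun i hi => by omega, ?_, ?_⟩
    · rw [← hN]; simp [finrank_zero_of_subsingleton]
    · constructor <;> intros <;> simp
  obtain ⟨m, e, f, hm1, hm, hef⟩ := h.exists_pair
  have pe : ∀ k l, b ((x ^ k) e) ((x ^ l) f) = if k + l + 1 = m then 1 else 0 := by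
    intro k l
    rw [← h.adj_pow, ← Module.End.mul_apply, ← pow_add, hef, add_comm l k]
  have pf : ∀ k l, b ((x ^ k) f) ((x ^ l) e) = if k + l + 1 = m then 1 else 0 := by
    intro k l
    rw [h.symm, pe, add_comm l k]
  have pp : ∀ (v : V) k l, b ((x ^ k) v) ((x ^ l) v) = 0 := by
    intro v k l
    rw [← h.adj_pow, ← Module.End.mul_apply, ← pow_add, h.pow_self]
  -- coordinates
  set Phi : V →ₗ[F] (Fin m → F) × (Fin m → F) :=
    LinearMap.prod (LinearMap.pi fun k : Fin m => b.flip ((x ^ (m - 1 - k)) f))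
      (LinearMap.pi fun k : Fin m => b.flip ((x ^ (m - 1 - k)) e)) with hPhi
  set s : (Fin m → F) × (Fin m → F) → V := fun c =>
    (∑ k : Fin m, c.1 k • (x ^ (k : ℕ)) e) + ∑ k : Fin m, c.2 k • (x ^ (k : ℕ)) f with hs
  have hP1 : ∀ v k, (Phi v).1 k = b v ((x ^ (m - 1 - (k : ℕ))) f) := fun _ _ => rfl
  have hP2 : ∀ v k, (Phi v).2 k = b v ((x ^ (m - 1 - (k : ℕ))) e) := fun _ _ => rfl
  have hPs : ∀ c, Phi (s c) = c := by
    intro c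
    refine Prod.ext ?_ ?_ <;> funext k
    · have := k.2
      rw [hP1]
      simp only [hs, map_add,
        map_sum, map_smul, LinearMap.add_apply, LinearMap.sum_apply, LinearMap.smul_apply, pe, pp,
        smul_zero, Finset.sum_const_zero, add_zero, smul_eq_mul, mul_ite, mul_one, mul_zero]
      rw [Finset.sum_eq_single k]
      · rw [if_pos (by omega)]
      · intro j _ hj
        rw [if_neg]
        intro hc
        exact hj (Fin.ext (by omega))
      · simp
    · have := k.2
      rw [hP2]
      simp only [hs, map_add,
        map_sum, map_smul, LinearMap.add_apply, LinearMap.sum_apply, LinearMap.smul_apply, pf, pp,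
        smul_zero, Finset.sum_const_zero, zero_add, smul_eq_mul, mul_ite, mul_one, mul_zero]
      rw [Finset.sum_eq_single k]
      · rw [if_pos (by omega)]
      · intro j _ hj
        rw [if_neg]
        intro hc
        exact hj (Fin.ext (by omega))
      · simp
  set U := LinearMap.ker Phi with hU
  have memU : ∀ u, u ∈ U ↔ (∀ k, b u ((x ^ k) f) = 0) ∧ (∀ k, b u ((x ^ k) e) = 0) := by
    intro u
    rw [hU, LinearMap.mem_ker]
    constructor
    · intro hu
      constructor
      · intro k
        by_cases hk : k < m
        · have := congrFun (congrArg Prod.fst hu) ⟨m - 1 - k, by omega⟩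
          rw [hP1] at this; change b u _ = 0 at this; simp only at this
          rwa [show m - 1 - (m - 1 - k) = k by omega] at this
        · rw [pow_eq_zero_of_le (by omega) hm]; simp
      · intro k
        by_cases hk : k < m
        · have := congrFun (congrArg Prod.snd hu) ⟨m - 1 - k, by omega⟩
          rw [hP2] at this; change b u _ = 0 at this; simp only at this
          rwa [show m - 1 - (m - 1 - k) = k by omega] at this
        · rw [pow_eq_zero_of_le (by omega) hm]; simp
    · rintro ⟨h1, h2⟩
      refine Prod.ext ?_ ?_ <;> funext k
      · exact h1 _
      · exact h2 _
  have hxU : ∀ u ∈ U, x u ∈ U := by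
    intro u hu
    rw [memU] at hu ⊢
    constructor
    · intro k
      rw [h.adj, ← Module.End.mul_apply, ← pow_succ']; exact hu.1 _
    · intro k
      rw [h.adj, ← Module.End.mul_apply, ← pow_succ']; exact hu.2 _
  have hsU : ∀ c, ∀ u ∈ U, b u (s c) = 0 := by
    intro c u hu
    rw [memU] at hu
    simp [hs, hu.1, hu.2]
  have hfin : finrank F U + 2 * m = N := by
    have h1 := LinearMap.finrank_range_add_finrank_ker Phi
    have h2 : LinearMap.range Phi = ⊤ := LinearMap.range_eq_top.2 fun c => ⟨s c, hPs c⟩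
    rw [h2, finrank_top, hN] at h1
    simp at h1
    have hU' : finrank F U = finrank F (LinearMap.ker Phi) := rfl
    omega
  have hpowU : ∀ k (u : U), (((x.restrict hxU) ^ k) u : V) = (x ^ k) u := by
    intro k u
    induction k generalizing u with
    | zero => simp
    | succ k ih => rw [pow_succ, Module.End.mul_apply, ih, pow_succ, Module.End.mul_apply]; rfl
  have hSN : SN (b.restrict U) (x.restrict hxU) := by
    refine ⟨fun v => h.alt _, fun u hu => ?_, fun v => h.sa _, ?_⟩
    · apply Subtype.ext
      apply h.nd
      intro w
      have hw : w - s (Phi w) ∈ U := by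
        rw [hU, LinearMap.mem_ker, map_sub, hPs, sub_self]
      have h1 := hu ⟨_, hw⟩
      have h2 : b u (w - s (Phi w)) = 0 := h1
      rw [map_sub, hsU _ _ u.2, sub_zero] at h2
      exact h2
    · refine ⟨m, ?_⟩
      ext u
      rw [hpowU, hm]; simp
  obtain ⟨r, lam, e', f', hanti, hz, hpos, hsum, hJS⟩ :=
    ih (finrank F U) (by omega) U (b.restrict U) (x.restrict hxU) hSN rfl
  have hbU : ∀ k l (u w : U), b ((x ^ k) u) ((x ^ l) w) =
      b.restrict U (((x.restrict hxU) ^ k) u) (((x.restrict hxU) ^ l) w) := by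
    intro k l u w
    rw [← hpowU, ← hpowU]; rfl
  have hlm : lam 0 ≤ m := by
    by_contra hc
    push Not at hc
    have h1 := hJS.ef 0 0 (lam 0 - 1) 0
    rw [if_pos ⟨rfl, by omega⟩, ← hbU, pow_eq_zero_of_le (by omega) hm] at h1
    simp at h1
  have hUe : ∀ (u : U) k l, b ((x ^ k) u) ((x ^ l) e) = 0 := by
    intro u k l
    rw [h.adj_pow, ← Module.End.mul_apply, ← pow_add]; exact ((memU _).1 u.2).2 _
  have hUf : ∀ (u : U) k l, b ((x ^ k) u) ((x ^ l) f) = 0 := by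
    intro u k l
    rw [h.adj_pow, ← Module.End.mul_apply, ← pow_add]; exact ((memU _).1 u.2).1 _
  refine ⟨r + 1, fun i => Nat.casesOn i m lam, fun i => Nat.casesOn i e fun j => (e' j : V),
    fun i => Nat.casesOn i f fun j => (f' j : V), ?_, ?_, ?_, ?_, ?_⟩
  · apply antitone_nat_of_succ_le
    intro i
    cases i with
    | zero => exact hlm
    | succ i => exact hanti (Nat.le_succ i)
  · intro i hi
    cases i with
    | zero => omega
    | succ i => exact hz i (by omega)
  · intro i hi
    cases i with
    | zero => exact hm1
    | succ i => exact hpos i (by omega)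
  · rw [Finset.sum_range_succ']
    show N = 2 * (∑ i ∈ range r, lam i + m)
    omega
  · constructor
    · intro i j k l
      cases i <;> cases j
      · exact pp _ _ _
      · rw [h.symm]; exact hUe _ _ _
      · exact hUe _ _ _
      · show b ((x ^ k) (e' _ : V)) ((x ^ l) (e' _ : V)) = 0
        rw [hbU, hJS.ee]
    · intro i j k l
      cases i <;> cases j
      · exact pp _ _ _
      · rw [h.symm]; exact hUf _ _ _
      · exact hUf _ _ _
      · show b ((x ^ k) (f' _ : V)) ((x ^ l) (f' _ : V)) = 0
        rw [hbU, hJS.ff]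
    · intro i j k l
      cases i <;> cases j
      · simpa using pe k l
      · rw [if_neg (by omega), h.symm]; exact hUe _ _ _
      · rw [if_neg (by omega)]; exact hUf _ _ _
      · rename_i i j
        show b ((x ^ k) (e' _ : V)) ((x ^ l) (f' _ : V)) = if i + 1 = j + 1 ∧ k + l + 1 = lam i then 1 else 0
        rw [hbU, hJS.ef]
        simp
    · intro i
      cases i with
      | zero => show (x ^ m) e = 0; rw [hm]; rfl
      | succ i =>
        show (x ^ (lam i)) (e' i : V) = 0
        rw [← hpowU, hJS.xe]; rfl
    · intro i
      cases i with
      | zero => show (x ^ m) f = 0; rw [hm]; rfl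
      | succ i =>
        show (x ^ (lam i)) (f' i : V) = 0
        rw [← hpowU, hJS.xf]; rfl


abbrev JIdx (n : ℕ) (lam : ℕ → ℕ) : Type := (Σ i : Fin n, Fin (lam i)) ⊕ (Σ i : Fin n, Fin (lam i))

section
variable {F V : Type*} [Field F] [CharP F 2] [AddCommGroup V] [Module F V]
    [FiniteDimensional F V]
    {b : LinearMap.BilinForm F V} {x : Module.End F V}

def jvec (n : ℕ) (x : Module.End F V) (lam : ℕ → ℕ) (e f : ℕ → V) : JIdx n lam → V
  | Sum.inl ⟨i, k⟩ => (x ^ (k : ℕ)) (e i)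
  | Sum.inr ⟨i, k⟩ => (x ^ (k : ℕ)) (f i)

def jdual (n : ℕ) (x : Module.End F V) (lam : ℕ → ℕ) (e f : ℕ → V) : JIdx n lam → V
  | Sum.inl ⟨i, k⟩ => (x ^ (lam i - 1 - (k : ℕ))) (f i)
  | Sum.inr ⟨i, k⟩ => (x ^ (lam i - 1 - (k : ℕ))) (e i)

theorem JS.pair {lam : ℕ → ℕ} {e f : ℕ → V} (hb : ∀ u v, b u v = b v u) (J : JS b x lam e f) (n : ℕ)
    (s t : JIdx n lam) :
    b (jvec n x lam e f s) (jdual n x lam e f t) = if s = t then 1 else 0 := by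
  have aux : ∀ (i j : Fin n) (k : Fin (lam i)) (l : Fin (lam j)),
      ((i : ℕ) = (j : ℕ) ∧ (k : ℕ) + (lam j - 1 - (l : ℕ)) + 1 = lam i) ↔
      (⟨i, k⟩ : Σ i : Fin n, Fin (lam i)) = ⟨j, l⟩ := by
    intro i j k l
    constructor
    · rintro ⟨h1, h2⟩
      have := Fin.ext h1
      subst this
      have := l.2
      have := k.2
      congr 1
      exact Fin.ext (by omega)
    · intro h
      cases h
      have := k.2
      exact ⟨rfl, by omega⟩
  rcases s with ⟨i, k⟩ | ⟨i, k⟩ <;> rcases t with ⟨j, l⟩ | ⟨j, l⟩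
  · simp only [jvec, jdual, J.ef, aux, Sum.inl.injEq]
  · simp [jvec, jdual, J.ee]
  · simp [jvec, jdual, J.ff]
  · simp only [jvec, jdual]
    rw [hb, J.ef]
    simp only [Sum.inr.injEq]
    simp only [← aux]
    congr 1
    apply propext
    constructor
    · rintro ⟨h1, h2⟩
      have := Fin.ext h1
      subst this
      exact ⟨rfl, by omega⟩
    · rintro ⟨h1, h2⟩
      have := Fin.ext h1
      subst this
      exact ⟨rfl, by omega⟩

theorem JS.linInd {lam : ℕ → ℕ} {e f : ℕ → V} (hb : ∀ u v, b u v = b v u) (J : JS b x lam e f) (n : ℕ) :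
    LinearIndependent F (jvec n x lam e f) := by
  rw [Fintype.linearIndependent_iff]
  intro g hg t
  have := congrArg (fun v => b v (jdual n x lam e f t)) hg
  simpa [J.pair hb, -Fintype.sum_sum_type] using this

theorem card_JIdx (n : ℕ) (lam : ℕ → ℕ) (hs : ∑ i ∈ range n, lam i = n) :
    Fintype.card (JIdx n lam) = 2 * n := by
  rw [Fintype.card_sum, Fintype.card_sigma]
  simp only [Fintype.card_fin]
  rw [Fin.sum_univ_eq_sum_range, hs]; ring

noncomputable def JS.basis {lam : ℕ → ℕ} {e f : ℕ → V} (hb : ∀ u v, b u v = b v u) (J : JS b x lam e f) (n : ℕ)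
    (hs : ∑ i ∈ range n, lam i = n) (hd : finrank F V = 2 * n) : Basis (JIdx n lam) F V :=
  basisOfLinearIndependentOfCardEqFinrank' (jvec n x lam e f) (J.linInd hb n)
    (by rw [card_JIdx n lam hs, hd])

theorem JS.basis_apply {lam : ℕ → ℕ} {e f : ℕ → V} (hb : ∀ u v, b u v = b v u) (J : JS b x lam e f) (n : ℕ)
    (hs : ∑ i ∈ range n, lam i = n) (hd : finrank F V = 2 * n) (s) :
    J.basis hb n hs hd s = jvec n x lam e f s := by
  simp [JS.basis]

theorem JS.expand {lam : ℕ → ℕ} {e f : ℕ → V} (hb : ∀ u v, b u v = b v u) (J : JS b x lam e f) (n : ℕ)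
    (hs : ∑ i ∈ range n, lam i = n) (hd : finrank F V = 2 * n) (v : V) :
    v = ∑ s, b v (jdual n x lam e f s) • jvec n x lam e f s := by
  have h1 := (J.basis hb n hs hd).sum_repr v
  simp only [J.basis_apply] at h1
  have h2 : ∀ t, b v (jdual n x lam e f t) = (J.basis hb n hs hd).repr v t := by
    intro t
    conv_lhs => rw [← h1]
    simp [J.pair hb, -Fintype.sum_sum_type]
  simp only [h2]
  exact h1.symm

theorem JS.lam_pos_lt {lam : ℕ → ℕ} {n : ℕ} (hz : ∀ i, n ≤ i → lam i = 0) {i k : ℕ} (h : k < lam i) : i < n := by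
  by_contra hc
  rw [hz i (by omega)] at h
  omega

/-- Two elements with Jordan systems of the same shape are conjugate by an isometry. -/
theorem JS.conj {V' : Type*} [AddCommGroup V'] [Module F V'] [FiniteDimensional F V']
    {b' : LinearMap.BilinForm F V'} {x' : Module.End F V'}
    {lam : ℕ → ℕ} {e f : ℕ → V} {e' f' : ℕ → V'} (hb : ∀ u v, b u v = b v u)
    (hb' : ∀ u v, b' u v = b' v u) (J : JS b x lam e f) (J' : JS b' x' lam e' f') (n : ℕ)
    (hs : ∑ i ∈ range n, lam i = n) (hd : finrank F V = 2 * n) (hd' : finrank F V' = 2 * n) :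
    ∃ g : V ≃ₗ[F] V', (∀ u w, b' (g u) (g w) = b u w) ∧ ∀ u, g (x u) = x' (g u) := by
  set g := (J.basis hb n hs hd).equiv (J'.basis hb' n hs hd') (Equiv.refl _) with hg
  have hgb : ∀ s, g (jvec n x lam e f s) = jvec n x' lam e' f' s := by
    intro s
    rw [← J.basis_apply hb n hs hd, ← J'.basis_apply hb' n hs hd']
    simp [hg]
  have hge : ∀ (i : Fin n) k, g ((x ^ k) (e i)) = (x' ^ k) (e' i) := by
    intro i k
    by_cases hk : k < lam i
    · exact hgb (Sum.inl ⟨i, ⟨k, hk⟩⟩)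
    · have h1 : (x ^ k) (e i) = 0 := by
        rw [show k = (k - lam i) + lam i by omega, pow_add, Module.End.mul_apply, J.xe, map_zero]
      have h2 : (x' ^ k) (e' i) = 0 := by
        rw [show k = (k - lam i) + lam i by omega, pow_add, Module.End.mul_apply, J'.xe, map_zero]
      rw [h1, h2, map_zero]
  have hgf : ∀ (i : Fin n) k, g ((x ^ k) (f i)) = (x' ^ k) (f' i) := by
    intro i k
    by_cases hk : k < lam i
    · exact hgb (Sum.inr ⟨i, ⟨k, hk⟩⟩)
    · have h1 : (x ^ k) (f i) = 0 := by
        rw [show k = (k - lam i) + lam i by omega, pow_add, Module.End.mul_apply, J.xf, map_zero]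
      have h2 : (x' ^ k) (f' i) = 0 := by
        rw [show k = (k - lam i) + lam i by omega, pow_add, Module.End.mul_apply, J'.xf, map_zero]
      rw [h1, h2, map_zero]
  refine ⟨g, ?_, ?_⟩
  · have : b'.compl₁₂ g.toLinearMap g.toLinearMap = b := by
      apply LinearMap.ext_basis (J.basis hb n hs hd) (J.basis hb n hs hd)
      intro s t
      simp only [LinearMap.compl₁₂_apply, J.basis_apply, LinearEquiv.coe_coe]
      rw [hgb, hgb]
      rcases s with ⟨i, k⟩ | ⟨i, k⟩ <;> rcases t with ⟨j, l⟩ | ⟨j, l⟩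
      · simp only [jvec, J.ee, J'.ee]
      · simp only [jvec, J.ef, J'.ef]
      · simp only [jvec]; rw [hb, hb', J.ef, J'.ef]
      · simp only [jvec, J.ff, J'.ff]
    intro u w
    rw [← this]; rfl
  · have : g.toLinearMap ∘ₗ x = x' ∘ₗ g.toLinearMap := by
      apply (J.basis hb n hs hd).ext
      intro s
      simp only [LinearMap.comp_apply, J.basis_apply, LinearEquiv.coe_coe]
      rw [hgb]
      rcases s with ⟨i, k⟩ | ⟨i, k⟩
      · simp only [jvec]
        rw [← Module.End.mul_apply, ← pow_succ', hge, pow_succ', Module.End.mul_apply]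
      · simp only [jvec]
        rw [← Module.End.mul_apply, ← pow_succ', hgf, pow_succ', Module.End.mul_apply]
    intro u
    exact LinearMap.congr_fun this u

/-- From a symplectic basis, every shape occurs. -/
theorem exists_shape (n : ℕ) (halt : ∀ v, b v v = 0) (hnd : ∀ v, (∀ w, b v w = 0) → v = 0)
    (hd : finrank F V = 2 * n) (lam : ℕ → ℕ) (hz : ∀ i, n ≤ i → lam i = 0)
    (hs : ∑ i ∈ range n, lam i = n) :
    ∃ (x : Module.End F V) (e f : ℕ → V), SN b x ∧ JS b x lam e f := by
  classical
  have h0 : SN b (0 : Module.End F V) := ⟨halt, hnd, by simp, IsNilpotent.zero⟩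
  have hb := h0.symm
  obtain ⟨r, mu, E, G, hanti, hz0, hpos, hsum, J0⟩ := SN.exists_JS (F := F) _ V b 0 h0 rfl
  have hmu : ∀ i, i < r → mu i = 1 := by
    intro i hi
    by_contra hc
    have := hpos i hi
    have h1 := J0.ef i i (mu i - 1) 0
    rw [if_pos ⟨rfl, by omega⟩, zero_pow (by omega)] at h1
    simp at h1
  have hr : r = n := by
    rw [Finset.sum_congr rfl (fun i hi => hmu i (Finset.mem_range.1 hi))] at hsum
    simp at hsum
    omega
  subst hr
  have hEE : ∀ i j, b (E i) (E j) = 0 := fun i j => by simpa using J0.ee i j 0 0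
  have hGG : ∀ i j, b (G i) (G j) = 0 := fun i j => by simpa using J0.ff i j 0 0
  have hEG : ∀ i j, i < r → b (E i) (G j) = if i = j then 1 else 0 := fun i j hi => by
    simpa [hmu i hi] using J0.ef i j 0 0
  -- relabel
  have hcard : Fintype.card (Σ i : Fin r, Fin (lam i)) = r := by
    rw [Fintype.card_sigma]
    simp only [Fintype.card_fin]
    rw [Fin.sum_univ_eq_sum_range, hs]
  obtain ⟨ρ⟩ : Nonempty ((Σ i : Fin r, Fin (lam i)) ≃ Fin r) :=
    ⟨Fintype.equivFinOfCardEq hcard⟩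
  -- basis
  let eo : ℕ → ℕ → V := fun i k => if h : i < r ∧ k < lam i then E (ρ ⟨⟨i, h.1⟩, ⟨k, h.2⟩⟩) else 0
  let fo : ℕ → ℕ → V := fun i k => if h : i < r ∧ k < lam i then
    G (ρ ⟨⟨i, h.1⟩, ⟨lam i - 1 - k, by have := h.2; show lam i - 1 - k < lam i; omega⟩⟩) else 0
  have hee : ∀ i j k l, b (eo i k) (eo j l) = 0 := by
    intro i j k l
    simp only [eo]
    split_ifs <;> simp [hEE]
  have hff : ∀ i j k l, b (fo i k) (fo j l) = 0 := by
    intro i j k l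
    simp only [fo]
    split_ifs <;> simp [hGG]
  have hef : ∀ i j k l, b (eo i k) (fo j l) = if i = j ∧ k + l + 1 = lam i then 1 else 0 := by
    intro i j k l
    simp only [eo, fo]
    by_cases h1 : i < r ∧ k < lam i
    · by_cases h2 : j < r ∧ l < lam j
      · rw [dif_pos h1, dif_pos h2, hEG _ _ (Fin.is_lt _)]
        congr 1
        apply propext
        rw [← Fin.ext_iff, ρ.apply_eq_iff_eq]
        constructor
        · intro h
          have hi : i = j := congrArg (fun s => (s.1 : ℕ)) h
          have hk : k = lam j - 1 - l := congrArg (fun s => (s.2 : ℕ)) h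
          subst hi
          exact ⟨rfl, by omega⟩
        · rintro ⟨h3, h4⟩
          subst h3
          congr 1
          exact Fin.ext (by simp only []; omega)
      · rw [dif_neg h2, if_neg]
        · simp
        · rintro ⟨h3, h4⟩
          subst h3
          exact h2 ⟨h1.1, by omega⟩
    · rw [dif_neg h1, if_neg]
      · simp
      · rintro ⟨h3, h4⟩
        have : k < lam i := by omega
        exact h1 ⟨JS.lam_pos_lt hz this, this⟩
  let bv : JIdx r lam → V := Sum.elim (fun s => eo s.1 s.2) (fun s => fo s.1 s.2)
  let dv : JIdx r lam → V := Sum.elim (fun s => fo s.1 (lam s.1 - 1 - s.2)) (fun s => eo s.1 (lam s.1 - 1 - s.2))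
  have aux : ∀ (i j : Fin r) (k : Fin (lam i)) (l : Fin (lam j)),
      ((i : ℕ) = (j : ℕ) ∧ (k : ℕ) + (lam j - 1 - (l : ℕ)) + 1 = lam i) ↔
      (⟨i, k⟩ : Σ i : Fin r, Fin (lam i)) = ⟨j, l⟩ := by
    intro i j k l
    constructor
    · rintro ⟨h1, h2⟩
      have := Fin.ext h1
      subst this
      have := l.2
      have := k.2
      congr 1
      exact Fin.ext (by omega)
    · intro h
      cases h
      have := k.2
      exact ⟨rfl, by omega⟩
  have hpair : ∀ s t, b (bv s) (dv t) = if s = t then 1 else 0 := by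
    intro s t
    rcases s with ⟨i, k⟩ | ⟨i, k⟩ <;> rcases t with ⟨j, l⟩ | ⟨j, l⟩
    · simp only [bv, dv, Sum.elim_inl, hef, aux, Sum.inl.injEq]
    · simp [bv, dv, hee]
    · simp [bv, dv, hff]
    · simp only [bv, dv, Sum.elim_inr]
      rw [hb, hef]
      simp only [Sum.inr.injEq]
      simp only [← aux]
      congr 1
      apply propext
      constructor
      · rintro ⟨h1, h2⟩
        have := Fin.ext h1
        subst this
        exact ⟨rfl, by omega⟩
      · rintro ⟨h1, h2⟩
        have := Fin.ext h1
        subst this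
        exact ⟨rfl, by omega⟩
  have hli : LinearIndependent F bv := by
    rw [Fintype.linearIndependent_iff]
    intro g hg t
    have := congrArg (fun v => b v (dv t)) hg
    simpa [hpair, -Fintype.sum_sum_type] using this
  let B : Basis (JIdx r lam) F V := basisOfLinearIndependentOfCardEqFinrank' bv hli
    (by rw [card_JIdx r lam hs, hd])
  have hB : ∀ s, B s = bv s := fun s => by simp [B]
  let x : Module.End F V := B.constr F (Sum.elim (fun s => eo s.1 (s.2 + 1)) (fun s => fo s.1 (s.2 + 1)))
  have hxe : ∀ i k, x (eo i k) = eo i (k + 1) := by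
    intro i k
    by_cases h : i < r ∧ k < lam i
    · have h1 : eo i k = B (Sum.inl ⟨⟨i, h.1⟩, ⟨k, h.2⟩⟩) := by rw [hB]; rfl
      rw [h1, Basis.constr_basis]; rfl
    · have h1 : eo i k = 0 := dif_neg h
      have h2 : eo i (k + 1) = 0 := dif_neg (by omega)
      rw [h1, h2, map_zero]
  have hxf : ∀ i k, x (fo i k) = fo i (k + 1) := by
    intro i k
    by_cases h : i < r ∧ k < lam i
    · have h1 : fo i k = B (Sum.inr ⟨⟨i, h.1⟩, ⟨k, h.2⟩⟩) := by rw [hB]; rfl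
      rw [h1, Basis.constr_basis]; rfl
    · have h1 : fo i k = 0 := dif_neg h
      have h2 : fo i (k + 1) = 0 := dif_neg (by omega)
      rw [h1, h2, map_zero]
  have hxpe : ∀ i k j, (x ^ k) (eo i j) = eo i (k + j) := by
    intro i k
    induction k with
    | zero => intro j; simp
    | succ k ih => intro j; rw [pow_succ, Module.End.mul_apply, hxe, ih]; congr 1; omega
  have hxpf : ∀ i k j, (x ^ k) (fo i j) = fo i (k + j) := by
    intro i k
    induction k with
    | zero => intro j; simp
    | succ k ih => intro j; rw [pow_succ, Module.End.mul_apply, hxf, ih]; congr 1; omega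
  have hadj : b ∘ₗ x = b.compl₂ x := by
    apply LinearMap.ext_basis B B
    intro s t
    simp only [LinearMap.comp_apply, LinearMap.compl₂_apply, hB]
    rcases s with ⟨i, k⟩ | ⟨i, k⟩ <;> rcases t with ⟨j, l⟩ | ⟨j, l⟩
    · simp only [bv, Sum.elim_inl, hxe, hee]
    · simp only [bv, Sum.elim_inl, Sum.elim_inr, hxe, hxf, hef]
      congr 2
      apply propext
      omega
    · simp only [bv, Sum.elim_inl, Sum.elim_inr, hxe, hxf]
      rw [hb, hb (fo _ _), hef, hef]
      congr 2
      apply propext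
      omega
    · simp only [bv, Sum.elim_inr, hxf, hff]
  have hadj' : ∀ u v, b (x u) v = b u (x v) := fun u v => LinearMap.congr_fun (LinearMap.congr_fun hadj u) v
  have hsa : ∀ v, b (x v) v = 0 := by
    intro v
    have hv : v ∈ Submodule.span F (Set.range B) := by rw [B.span_eq]; trivial
    induction hv using Submodule.span_induction with
    | mem y hy =>
      obtain ⟨s, rfl⟩ := hy
      rw [hB]
      rcases s with ⟨i, k⟩ | ⟨i, k⟩
      · simp only [bv, Sum.elim_inl, hxe, hee]
      · simp only [bv, Sum.elim_inr, hxf, hff]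
    | zero => simp
    | add y z _ _ hy hz =>
      simp only [map_add, LinearMap.add_apply, hy, hz, add_zero, zero_add]
      rw [hadj', hb z]
      exact CharTwo.add_self_eq_zero _
    | smul a y _ hy => simp [hy]
  have heo0 : ∀ i k, lam i ≤ k → eo i k = 0 := fun i k h => dif_neg (by omega)
  have hfo0 : ∀ i k, lam i ≤ k → fo i k = 0 := fun i k h => dif_neg (by omega)
  refine ⟨x, fun i => eo i 0, fun i => fo i 0, ⟨halt, hnd, hsa, ?_⟩, ?_, ?_, ?_, ?_, ?_⟩
  · refine ⟨r, ?_⟩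
    have hle : ∀ i : Fin r, lam i ≤ r := by
      intro i
      have := Finset.single_le_sum (f := lam) (fun i _ => Nat.zero_le _) (Finset.mem_range.2 i.2)
      omega
    apply B.ext
    intro s
    rw [hB]
    rcases s with ⟨i, k⟩ | ⟨i, k⟩
    · have := hle i
      simp only [bv, Sum.elim_inl, hxpe]
      rw [heo0 _ _ (by omega)]; simp
    · have := hle i
      simp only [bv, Sum.elim_inr, hxpf]
      rw [hfo0 _ _ (by omega)]; simp
  · intro i j k l
    rw [hxpe, hxpe, hee]
  · intro i j k l
    rw [hxpf, hxpf, hff]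
  · intro i j k l
    rw [hxpe, hxpf, hef]; simp
  · intro i
    rw [hxpe]; exact heo0 _ _ (by omega)
  · intro i
    rw [hxpf]; exact hfo0 _ _ (by omega)

end


def Aset (lam : ℕ → ℕ) : Type :=
  {a : ℕ → ℕ // Antitone a ∧ (∀ i, a i ≤ lam i) ∧ Antitone (fun i => lam i - a i)}

instance (lam : ℕ → ℕ) : PartialOrder (Aset lam) :=
  inferInstanceAs (PartialOrder {a : ℕ → ℕ // Antitone a ∧ (∀ i, a i ≤ lam i) ∧ Antitone (fun i => lam i - a i)})

theorem Aset.finite {lam : ℕ → ℕ} {n : ℕ} (hz : ∀ i, n ≤ i → lam i = 0) : Finite (Aset lam) := by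
  let φ : Aset lam → ((i : Fin n) → Fin (lam i + 1)) := fun a i =>
    ⟨a.1 i, Nat.lt_succ_of_le (a.2.2.1 i)⟩
  apply Finite.of_injective φ
  intro a c h
  apply Subtype.ext
  funext i
  by_cases hi : i < n
  · have := congrFun h ⟨i, hi⟩
    exact Fin.ext_iff.1 this
  · have h1 := a.2.2.1 i
    have h2 := c.2.2.1 i
    have := hz i (by omega)
    omega

def Aset.sig {lam : ℕ → ℕ} (a : Aset lam) : Aset lam :=
  ⟨fun i => lam i - a.1 i, a.2.2.2, fun i => Nat.sub_le _ _, by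
    have : (fun i => lam i - (lam i - a.1 i)) = a.1 := by
      funext i
      have := a.2.2.1 i
      omega
    rw [this]; exact a.2.1⟩

section
variable {F V : Type*} [Field F] [CharP F 2] [AddCommGroup V] [Module F V]
    [FiniteDimensional F V]
    {b : LinearMap.BilinForm F V} {x : Module.End F V}

def Ssub (x : Module.End F V) (e f : ℕ → V) (c : ℕ → ℕ) : Submodule F V :=
  Submodule.span F {v | ∃ i k, c i ≤ k ∧ (v = (x ^ k) (e i) ∨ v = (x ^ k) (f i))}

theorem Ssub_anti (e f : ℕ → V) {c d : ℕ → ℕ} (h : ∀ i, c i ≤ d i) : Ssub x e f d ≤ Ssub x e f c := by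
  apply Submodule.span_mono
  rintro v ⟨i, k, h1, h2⟩
  exact ⟨i, k, (h i).trans h1, h2⟩

theorem mem_Ssub {lam : ℕ → ℕ} {e f : ℕ → V} (hb : ∀ u v, b u v = b v u) (J : JS b x lam e f) {n : ℕ}
    (hs : ∑ i ∈ range n, lam i = n) (hd : finrank F V = 2 * n) (c : ℕ → ℕ) (v : V) :
    v ∈ Ssub x e f c ↔ ∀ i l, lam i ≤ l + c i → b v ((x ^ l) (e i)) = 0 ∧ b v ((x ^ l) (f i)) = 0 := by
  constructor
  · intro hv i l hl
    induction hv using Submodule.span_induction with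
    | mem y hy =>
      obtain ⟨j, k, h1, rfl | rfl⟩ := hy
      · refine ⟨J.ee _ _ _ _, ?_⟩
        rw [J.ef, if_neg]
        rintro ⟨rfl, h2⟩
        omega
      · refine ⟨?_, J.ff _ _ _ _⟩
        rw [hb, J.ef, if_neg]
        rintro ⟨rfl, h2⟩
        omega
    | zero => simp
    | add y z _ _ hy hz => simp [hy.1, hy.2, hz.1, hz.2]
    | smul a y _ hy => simp [hy.1, hy.2]
  · intro h
    rw [J.expand hb n hs hd v]
    apply Submodule.sum_mem
    rintro (⟨i, k⟩ | ⟨i, k⟩) -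
    · by_cases hk : c i ≤ k
      · exact Submodule.smul_mem _ _ (Submodule.subset_span ⟨i, k, hk, Or.inl rfl⟩)
      · have := k.2
        have h0 : b v (jdual n x lam e f (Sum.inl ⟨i, k⟩)) = 0 := (h i _ (by omega)).2
        rw [h0, zero_smul]; exact zero_mem _
    · by_cases hk : c i ≤ k
      · exact Submodule.smul_mem _ _ (Submodule.subset_span ⟨i, k, hk, Or.inr rfl⟩)
      · have := k.2
        have h0 : b v (jdual n x lam e f (Sum.inr ⟨i, k⟩)) = 0 := (h i _ (by omega)).1
        rw [h0, zero_smul]; exact zero_mem _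

theorem pow_kill {lam : ℕ → ℕ} {e : ℕ → V} (he : ∀ i, (x ^ (lam i)) (e i) = 0) {i k : ℕ} (h : lam i ≤ k) :
    (x ^ k) (e i) = 0 := by
  rw [show k = (k - lam i) + lam i by omega, pow_add, Module.End.mul_apply, he, map_zero]

theorem Njl_eq {lam : ℕ → ℕ} {e f : ℕ → V} (h : SN b x) (J : JS b x lam e f) {n : ℕ}
    (hs : ∑ i ∈ range n, lam i = n) (hd : finrank F V = 2 * n) (j l : ℕ) :
    Njl x j l = Ssub x e f (fun i => min j (lam i - l)) := by
  have hr : LinearMap.range (x ^ j) = Ssub x e f (fun _ => j) := by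
    apply le_antisymm
    · rintro _ ⟨u, rfl⟩
      rw [mem_Ssub h.symm J hs hd]
      intro i m hm
      rw [h.adj_pow, h.adj_pow, ← Module.End.mul_apply, ← Module.End.mul_apply, ← pow_add,
        pow_kill J.xe (by omega), pow_kill J.xf (by omega)]
      simp
    · rw [Ssub, Submodule.span_le]
      rintro v ⟨i, k, h1, rfl | rfl⟩
      · exact ⟨(x ^ (k - j)) (e i), by rw [← Module.End.mul_apply, ← pow_add]; congr 2; omega⟩
      · exact ⟨(x ^ (k - j)) (f i), by rw [← Module.End.mul_apply, ← pow_add]; congr 2; omega⟩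
  have hk : LinearMap.ker (x ^ l) = Ssub x e f (fun i => lam i - l) := by
    apply le_antisymm
    · intro v hv
      rw [LinearMap.mem_ker] at hv
      rw [mem_Ssub h.symm J hs hd]
      intro i m hm
      by_cases hml : l ≤ m
      · have e1 : ∀ u, (x ^ m) u = (x ^ l) ((x ^ (m - l)) u) := by
          intro u
          rw [← Module.End.mul_apply, ← pow_add]; congr 2; omega
        rw [e1, e1, ← h.adj_pow l, hv, ← h.adj_pow l, hv]; simp
      · rw [pow_kill J.xe (by omega), pow_kill J.xf (by omega)]; simp
    · rw [Ssub, Submodule.span_le]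
      rintro v ⟨i, k, h1, rfl | rfl⟩
      · rw [SetLike.mem_coe, LinearMap.mem_ker, ← Module.End.mul_apply, ← pow_add, pow_kill J.xe (by omega)]
      · rw [SetLike.mem_coe, LinearMap.mem_ker, ← Module.End.mul_apply, ← pow_add, pow_kill J.xf (by omega)]
  rw [Njl, hr, hk]
  apply le_antisymm
  · apply sup_le <;> apply Ssub_anti <;> intro i
    · exact min_le_left _ _
    · exact min_le_right _ _
  · conv_lhs => rw [Ssub]
    rw [Submodule.span_le]
    rintro v ⟨i, k, h1, h2⟩
    rcases min_le_iff.1 h1 with h1 | h1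
    · exact Submodule.mem_sup_left (Submodule.subset_span ⟨i, k, h1, h2⟩)
    · exact Submodule.mem_sup_right (Submodule.subset_span ⟨i, k, h1, h2⟩)

theorem exists_lab {lam : ℕ → ℕ} {e f : ℕ → V} (h : SN b x) (J : JS b x lam e f) {n : ℕ}
    (hl : Antitone lam) (hz : ∀ i, n ≤ i → lam i = 0)
    (hs : ∑ i ∈ range n, lam i = n) (hd : finrank F V = 2 * n) :
    ∃ (M : Aset lam → Submodule F V) (lab : V → Aset lam), Function.Surjective lab ∧
      (∀ v c, v ∈ M c ↔ c ≤ lab v) ∧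
      (∀ v w, lab v = lab w ↔ ∃ g ∈ Gx b x, g v = w) ∧
      (∀ c v, v ∈ M (c.sig) ↔ ∀ w ∈ M c, b v w = 0) := by
  classical
  have hfin := Aset.finite hz
  have := Fintype.ofFinite (Aset lam)
  have hb := h.symm
  set M : Aset lam → Submodule F V := fun c => Ssub x e f c.1 with hM
  let z : Aset lam := ⟨fun _ => 0, fun _ _ _ => le_rfl, fun _ => Nat.zero_le _, by simpa using hl⟩
  have hzM : ∀ v, v ∈ M z := by
    intro v
    show v ∈ Ssub x e f _
    rw [mem_Ssub hb J hs hd]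
    intro i l hil
    have hil' : lam i ≤ l := by simpa [z] using hil
    rw [pow_kill J.xe hil', pow_kill J.xf hil']; simp
  let la : V → ℕ → ℕ := fun v i => (univ.filter fun c => v ∈ M c).sup (fun c => c.1 i)
  have hla : ∀ v i, ∃ c, v ∈ M c ∧ la v i = c.1 i := by
    intro v i
    obtain ⟨c, hc, h2⟩ := Finset.exists_mem_eq_sup (univ.filter fun c => v ∈ M c) ⟨z, by simp [hzM]⟩ (fun c => c.1 i)
    exact ⟨c, by simpa using hc, h2⟩
  have hle : ∀ v c i, v ∈ M c → c.1 i ≤ la v i := by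
    intro v c i hc
    exact Finset.le_sup (f := fun c : Aset lam => c.1 i) (by simpa using hc)
  have hlaA : ∀ v, Antitone (la v) ∧ (∀ i, la v i ≤ lam i) ∧ Antitone (fun i => lam i - la v i) := by
    intro v
    refine ⟨?_, ?_, ?_⟩
    · intro i j hij
      obtain ⟨c, hc, h2⟩ := hla v j
      rw [h2]
      exact (c.2.1 hij).trans (hle v c i hc)
    · intro i
      obtain ⟨c, hc, h2⟩ := hla v i
      rw [h2]; exact c.2.2.1 i
    · intro i j hij
      obtain ⟨c, hc, h2⟩ := hla v i
      show lam j - la v j ≤ lam i - la v i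
      rw [h2]
      have h3 : lam j - c.1 j ≤ lam i - c.1 i := c.2.2.2 hij
      have h4 := hle v c j hc
      omega
  let lab : V → Aset lam := fun v => ⟨la v, hlaA v⟩
  have hlab : ∀ v c, v ∈ M c ↔ c ≤ lab v := by
    intro v c
    constructor
    · intro hc i
      exact hle v c i hc
    · intro hc
      have h1 : v ∈ M (lab v) := by
        show v ∈ Ssub x e f _
        rw [mem_Ssub hb J hs hd]
        intro i l hil
        obtain ⟨d, hd1, hd2⟩ := hla v i
        have hd3 : v ∈ Ssub x e f d.1 := hd1
        rw [mem_Ssub hb J hs hd] at hd3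
        apply hd3
        rw [← hd2]; exact hil
      exact Ssub_anti e f hc h1
  refine ⟨M, lab, ?_, hlab, ?_, ?_⟩
  · intro a
    set va : V := ∑ i ∈ range n, (x ^ (a.1 i)) (e i) with hva
    have h1 : ∀ c : Aset lam, va ∈ M c ↔ c ≤ a := by
      intro c
      show va ∈ Ssub x e f _ ↔ _
      constructor
      · rw [mem_Ssub hb J hs hd]
        intro hv i
        by_contra hc
        have hc : a.1 i < c.1 i := not_le.1 hc
        have h2 := c.2.2.1 i
        have hi : i < n := by
          by_contra hi
          have := hz i (by omega)
          omega
        have h3 := (hv i (lam i - 1 - a.1 i) (by omega)).2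
        rw [hva, map_sum, LinearMap.sum_apply, Finset.sum_eq_single i, J.ef, if_pos ⟨rfl, by omega⟩] at h3
        · exact one_ne_zero h3
        · intro j _ hj
          rw [J.ef, if_neg (by tauto)]
        · intro h4; simp at h4; omega
      · intro hc
        apply Submodule.sum_mem
        intro i _
        exact Submodule.subset_span ⟨i, _, hc i, Or.inl rfl⟩
    refine ⟨va, le_antisymm ?_ ?_⟩
    · rw [← h1, hlab]
    · rw [← hlab, h1]
  · intro v w
    constructor
    · intro hvw
      apply h.transitive
      intro j l
      let c : Aset lam := ⟨fun i => min j (lam i - l), by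
        intro i i' hii
        have := hl hii
        simp only
        omega, fun i => by simp only; omega, by
        intro i i' hii
        have := hl hii
        simp only
        omega⟩
      have hc : Njl x j l = M c := Njl_eq h J hs hd j l
      rw [hc, hlab, hlab, hvw]
    · rintro ⟨g, hg, rfl⟩
      have key : ∀ (a : Aset lam) u, u ∈ M a ↔ ∀ i, u ∈ Njl x (a.1 i) (lam i - a.1 i) := by
        intro a u
        constructor
        · intro hu i
          rw [Njl_eq h J hs hd]
          refine Ssub_anti e f ?_ hu
          intro j
          rcases le_total j i with hij | hij
          · have := a.2.1 hij
            omega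
          · have h2 : lam j - a.1 j ≤ lam i - a.1 i := a.2.2.2 hij
            have := a.2.2.1 j
            have := a.2.2.1 i
            omega
        · intro hu
          show u ∈ Ssub x e f _
          rw [mem_Ssub hb J hs hd]
          intro i l hil
          have h1 := hu i
          rw [Njl_eq h J hs hd, mem_Ssub hb J hs hd] at h1
          apply h1
          have := a.2.2.1 i
          omega
      have key2 : ∀ c, v ∈ M c ↔ g v ∈ M c := by
        intro c
        rw [key, key]
        apply forall_congr'
        intro i
        rw [Gx_Njl hg]
      apply le_antisymm
      · rw [← hlab, ← key2, hlab]
      · rw [← hlab, key2, hlab]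
  · intro c v
    show v ∈ Ssub x e f _ ↔ ∀ w ∈ Ssub x e f _, _
    rw [mem_Ssub hb J hs hd]
    constructor
    · intro hv w hw
      rw [Ssub] at hw
      induction hw using Submodule.span_induction with
      | mem y hy =>
        obtain ⟨j, k, h1, h2⟩ := hy
        have h4 := c.2.2.1 j
        have h3 := hv j k (by simp only [Aset.sig]; omega)
        rcases h2 with rfl | rfl
        · exact h3.1
        · exact h3.2
      | zero => simp
      | add y z _ _ hy hz => simp [hy, hz]
      | smul a y _ hy => simp [hy]
    · intro hv i l hil
      have h4 := c.2.2.1 i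
      simp only [Aset.sig] at hil
      by_cases hcl : c.1 i ≤ l
      · exact ⟨hv _ (Submodule.subset_span ⟨i, l, hcl, Or.inl rfl⟩),
          hv _ (Submodule.subset_span ⟨i, l, hcl, Or.inr rfl⟩)⟩
      · omega
end


structure Psi {F : Type*} [Field F] (ψ : F → ℤ) : Prop where
  zero : ψ 0 = 1
  add : ∀ a c, ψ (a + c) = ψ a * ψ c
  sq : ∀ a, ψ (a * a) = ψ a
  pm : ∀ a, ψ a = 1 ∨ ψ a = -1
  nt : ∃ a, ψ a = -1

theorem exists_psi (F : Type*) [Field F] [Finite F] [CharP F 2] : ∃ ψ : F → ℤ, Psi ψ := by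
  classical
  let _ : Algebra (ZMod 2) F := ZMod.algebra F 2
  let P : F →ₗ[ZMod 2] F := (AddMonoidHom.mk' (fun a : F => a * a + a) (by
    intro a c
    have : a * c + a * c = 0 := CharTwo.add_self_eq_zero _
    linear_combination this)).toZModLinearMap 2
  have hP : ∀ a, P a = a * a + a := fun a => rfl
  have h1 : ¬ Function.Injective P := by
    intro hi
    have : P 1 = P 0 := by rw [hP, hP]; simp [CharTwo.add_self_eq_zero]
    exact one_ne_zero (hi this)
  have h2 : LinearMap.range P < ⊤ := by
    rw [lt_top_iff_ne_top]
    intro h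
    exact h1 (Finite.injective_iff_surjective.2 (LinearMap.range_eq_top.1 h))
  obtain ⟨φ, hφ0, hφ⟩ := Submodule.exists_le_ker_of_lt_top _ h2
  have hz : ∀ z : ZMod 2, z = 0 ∨ z = 1 := by decide
  have hψ1 : ∀ a, (if φ a = 0 then (1 : ℤ) else -1) = 1 ∨ (if φ a = 0 then (1 : ℤ) else -1) = -1 := by
    intro a; split_ifs <;> simp
  refine ⟨fun a => if φ a = 0 then 1 else -1, by simp, ?_, ?_, hψ1, ?_⟩
  · intro a c
    rw [map_add]
    rcases hz (φ a) with ha | ha <;> rcases hz (φ c) with hc | hc <;> rw [ha, hc] <;> decide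
  · intro a
    have : φ (a * a + a) = 0 := hφ ⟨a, rfl⟩
    have h3 : φ (a * a) = φ a := by
      rw [map_add] at this
      rw [← sub_eq_zero, CharTwo.sub_eq_add, this]
    simp only [h3]
  · by_contra hc
    push Not at hc
    apply hφ0
    ext a
    by_contra ha
    exact hc a (if_neg ha)

section
variable {F V : Type*} [Field F] [Fintype F] [CharP F 2] [AddCommGroup V] [Module F V]
    [Fintype V] {b : LinearMap.BilinForm F V} {ψ : F → ℤ}

theorem sum_neg_equiv {α : Type*} [Fintype α] (φ : α → ℤ) (e : α ≃ α) (h : ∀ a, φ (e a) = - φ a) :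
    ∑ a, φ a = 0 := by
  have h1 : ∑ a, φ (e a) = ∑ a, φ a := Equiv.sum_comp e φ
  simp only [h, Finset.sum_neg_distrib] at h1
  omega

/-- quadratic forms (as functions) with polar form `b` -/
abbrev XT (b : LinearMap.BilinForm F V) : Type _ :=
  {Q : V → F // (∀ (c : F) v, Q (c • v) = c * c * Q v) ∧ ∀ u w, Q (u + w) = Q u + Q w + b u w}

noncomputable instance : Fintype (XT b) := by
  classical
  have : Finite (XT b) := inferInstanceAs (Finite {Q : V → F // (∀ (c : F) v, Q (c • v) = c * c * Q v) ∧ ∀ u w, Q (u + w) = Q u + Q w + b u w})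
  exact Fintype.ofFinite _

theorem XT.zero (Q : XT b) : Q.1 0 = 0 := by
  have := Q.2.1 0 0
  simpa using this

theorem sum_psi_b (hψ : Psi ψ) (hb : ∀ u v, b u v = b v u) (hnd : ∀ v, (∀ w, b v w = 0) → v = 0) [DecidableEq V] (u : V) :
    ∑ v, ψ (b v u) = if u = 0 then (Fintype.card V : ℤ) else 0 := by
  split_ifs with hu
  · subst hu; simp [hψ.zero]
  · obtain ⟨w, hw⟩ : ∃ w, b u w ≠ 0 := by
      by_contra hc
      push Not at hc
      exact hu (hnd u hc)
    obtain ⟨a, ha⟩ := hψ.nt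
    apply sum_neg_equiv _ (Equiv.addRight ((a / b u w) • w))
    intro v
    simp only [Equiv.coe_addRight, map_add, LinearMap.add_apply, map_smul, LinearMap.smul_apply, smul_eq_mul]
    rw [hψ.add, hb w u, div_mul_cancel₀ _ hw, ha]; ring

theorem sum_psi_X (hψ : Psi ψ) (hb : ∀ u v, b u v = b v u) (hnd : ∀ v, (∀ w, b v w = 0) → v = 0) [DecidableEq V] (v : V) :
    ∑ Q : XT b, ψ (Q.1 v) = if v = 0 then (Fintype.card (XT b) : ℤ) else 0 := by
  split_ifs with hv
  · subst hv; simp [hψ.zero, XT.zero]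
  · obtain ⟨w, hw⟩ : ∃ w, b v w ≠ 0 := by
      by_contra hc
      push Not at hc
      exact hv (hnd v hc)
    obtain ⟨a, ha⟩ := hψ.nt
    set u := (a / b v w) • w with hu
    have huv : b v u = a := by
      rw [hu, map_smul, smul_eq_mul, div_mul_cancel₀ _ hw]
    let T : XT b → XT b := fun Q => ⟨fun y => Q.1 y + b y u * b y u, by
      intro c y
      beta_reduce
      rw [Q.2.1]; simp only [map_smul, LinearMap.smul_apply, smul_eq_mul]; ring, by
      intro y z
      have : b y u * b z u + b y u * b z u = 0 := CharTwo.add_self_eq_zero _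
      beta_reduce
      rw [Q.2.2]; simp only [map_add, LinearMap.add_apply]
      linear_combination this⟩
    have hT : Function.Involutive T := by
      intro Q
      apply Subtype.ext
      funext y
      show Q.1 y + b y u * b y u + b y u * b y u = Q.1 y
      rw [add_assoc, CharTwo.add_self_eq_zero, add_zero]
    apply sum_neg_equiv _ hT.toPerm
    intro Q
    show ψ (Q.1 v + b v u * b v u) = _
    rw [hψ.add, hψ.sq, huv, ha]; ring

theorem sum_psi_QQ (hψ : Psi ψ) [DecidableEq (XT b)] (Q Q' : XT b) :
    ∑ v, ψ (Q.1 v + Q'.1 v) = if Q = Q' then (Fintype.card V : ℤ) else 0 := by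
  split_ifs with h
  · subst h
    simp [CharTwo.add_self_eq_zero, hψ.zero]
  · obtain ⟨u, hu⟩ : ∃ u, Q.1 u + Q'.1 u ≠ 0 := by
      by_contra hc
      push Not at hc
      apply h
      apply Subtype.ext
      funext u
      have := hc u
      rwa [← CharTwo.sub_eq_add, sub_eq_zero] at this
    obtain ⟨a, ha⟩ := hψ.nt
    obtain ⟨c, hc⟩ := FiniteField.isSquare_of_char_two (ringChar.eq F 2) (a / (Q.1 u + Q'.1 u))
    apply sum_neg_equiv _ (Equiv.addRight (c • u))
    intro v
    simp only [Equiv.coe_addRight]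
    rw [Q.2.2, Q'.2.2, Q.2.1, Q'.2.1, ← hc]
    have h1 : b v (c • u) + b v (c • u) = 0 := CharTwo.add_self_eq_zero _
    have h2 : Q.1 v + a / (Q.1 u + Q'.1 u) * Q.1 u + b v (c • u) + (Q'.1 v + a / (Q.1 u + Q'.1 u) * Q'.1 u + b v (c • u))
      = (Q.1 v + Q'.1 v) + a := by
      have h3 : a / (Q.1 u + Q'.1 u) * (Q.1 u + Q'.1 u) = a := div_mul_cancel₀ _ hu
      linear_combination h1 + h3
    rw [h2, hψ.add, ha]; ring

theorem card_XT (hψ : Psi ψ) (hb : ∀ u v, b u v = b v u) (hnd : ∀ v, (∀ w, b v w = 0) → v = 0) (Q0 : XT b) :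
    Fintype.card (XT b) = Fintype.card V := by
  classical
  have h1 : ∑ Q : XT b, ∑ v, ψ (Q.1 v + Q0.1 v) = Fintype.card V := by
    simp only [sum_psi_QQ hψ]
    simp
  rw [Finset.sum_comm] at h1
  simp only [hψ.add, ← Finset.sum_mul, sum_psi_X hψ hb hnd] at h1
  simp [XT.zero, hψ.zero] at h1
  exact_mod_cast h1

def gauss (ψ : F → ℤ) (Q : V → F) : ℤ := ∑ v, ψ (Q v)

theorem gauss_sq (hψ : Psi ψ) (hb : ∀ u v, b u v = b v u) (hnd : ∀ v, (∀ w, b v w = 0) → v = 0) (Q : XT b) :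
    gauss ψ Q.1 * gauss ψ Q.1 = Fintype.card V := by
  classical
  rw [gauss, Finset.sum_mul_sum]
  have h1 : ∀ v, ∑ w, ψ (Q.1 v) * ψ (Q.1 w) = ∑ u, ψ (Q.1 u) * ψ (b v u) := by
    intro v
    rw [← Equiv.sum_comp (Equiv.addLeft v)]
    apply Finset.sum_congr rfl
    intro u _
    simp only [Equiv.coe_addLeft]
    rw [Q.2.2, ← hψ.add, ← hψ.add]
    congr 1
    have : Q.1 v + Q.1 v = 0 := CharTwo.add_self_eq_zero _
    linear_combination this
  simp only [h1]
  rw [Finset.sum_comm]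
  simp only [← Finset.mul_sum, sum_psi_b hψ hb hnd]
  simp [XT.zero, hψ.zero]

/-- composition of a form with an isometry -/
def XT.comp (Q : XT b) (g : V ≃ₗ[F] V) (hg : ∀ u w, b (g u) (g w) = b u w) : XT b :=
  ⟨fun v => Q.1 (g v), fun c v => by beta_reduce; rw [map_smul, Q.2.1], fun u w => by beta_reduce; rw [map_add, Q.2.2, hg]⟩

theorem gauss_comp (Q : XT b) (g : V ≃ₗ[F] V) (hg : ∀ u w, b (g u) (g w) = b u w) :
    gauss ψ (Q.comp g hg).1 = gauss ψ Q.1 := Equiv.sum_comp g.toEquiv (fun v => ψ (Q.1 v))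

theorem card_fix (hψ : Psi ψ) (halt : ∀ v, b v v = 0) (hb : ∀ u v, b u v = b v u) (hnd : ∀ v, (∀ w, b v w = 0) → v = 0) (Q0 : XT b)
    (g : V ≃ₗ[F] V) (hg : ∀ u w, b (g u) (g w) = b u w) [DecidableEq V] [DecidableEq (XT b)] :
    (univ.filter fun Q : XT b => Q.comp g hg = Q).card = (univ.filter fun v : V => g v = v).card := by
  have h1 : ∑ Q : XT b, ∑ v, ψ (Q.1 (g v) + Q.1 v) = (univ.filter fun Q : XT b => Q.comp g hg = Q).card * Fintype.card V := by
    rw [Finset.card_filter, Nat.cast_sum, Finset.sum_mul]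
    apply Finset.sum_congr rfl
    intro Q _
    have := sum_psi_QQ hψ (Q.comp g hg) Q
    rw [show (∑ v, ψ (Q.1 (g v) + Q.1 v)) = ∑ v, ψ ((Q.comp g hg).1 v + Q.1 v) from rfl, this]
    split_ifs <;> simp
  have h2 : ∀ v, ∑ Q : XT b, ψ (Q.1 (g v) + Q.1 v) = if g v = v then (Fintype.card V : ℤ) else 0 := by
    intro v
    have h3 : ∀ Q : XT b, ψ (Q.1 (g v) + Q.1 v) = ψ (Q.1 (g v + v)) * ψ (b (g v) v) := by
      intro Q
      rw [← hψ.add, Q.2.2]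
      congr 1
      have : b (g v) v + b (g v) v = 0 := CharTwo.add_self_eq_zero _
      linear_combination - this
    simp only [h3, ← Finset.sum_mul, sum_psi_X hψ hb hnd, card_XT hψ hb hnd Q0]
    have h4 : g v + v = 0 ↔ g v = v := by
      have h5 : v + v = 0 := char2_add V F v
      constructor
      · intro h; exact add_right_cancel (h.trans h5.symm)
      · intro h; rw [h, h5]
    by_cases h6 : g v = v
    · rw [if_pos (h4.2 h6), if_pos h6, h6, halt, hψ.zero, mul_one]
    · rw [if_neg (fun h => h6 (h4.1 h)), if_neg h6, zero_mul]
  rw [Finset.sum_comm] at h1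
  simp only [h2] at h1
  rw [Finset.sum_ite, Finset.sum_const_zero, add_zero, Finset.sum_const, nsmul_eq_mul] at h1
  have h7 : (Fintype.card V : ℤ) ≠ 0 := by
    have : 0 < Fintype.card V := Fintype.card_pos
    omega
  exact_mod_cast (mul_right_cancel₀ h7 h1).symm

theorem sum_gauss_fix (hψ : Psi ψ) (halt : ∀ v, b v v = 0) (hb : ∀ u v, b u v = b v u) (hnd : ∀ v, (∀ w, b v w = 0) → v = 0) (Q0 : XT b)
    (g : V ≃ₗ[F] V) (hg : ∀ u w, b (g u) (g w) = b u w) [DecidableEq V] [DecidableEq (XT b)] :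
    ∑ Q ∈ (univ.filter fun Q : XT b => Q.comp g hg = Q), gauss ψ Q.1 = ∑ v, ψ (b (g v) v) := by
  have h1 : ∑ Q : XT b, (∑ v, ψ (Q.1 (g v) + Q.1 v)) * gauss ψ Q.1 =
      Fintype.card V * ∑ Q ∈ (univ.filter fun Q : XT b => Q.comp g hg = Q), gauss ψ Q.1 := by
    rw [Finset.sum_filter, Finset.mul_sum]
    apply Finset.sum_congr rfl
    intro Q _
    have := sum_psi_QQ hψ (Q.comp g hg) Q
    rw [show (∑ v, ψ (Q.1 (g v) + Q.1 v)) = ∑ v, ψ ((Q.comp g hg).1 v + Q.1 v) from rfl, this]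
    split_ifs <;> simp
  have h2 : ∀ v, ∑ w, ∑ Q : XT b, ψ (Q.1 (g v) + Q.1 v) * ψ (Q.1 w) = Fintype.card V * ψ (b (g v) v) := by
    intro v
    have h3 : ∀ (Q : XT b) w, ψ (Q.1 (g v) + Q.1 v) * ψ (Q.1 w) = ψ (Q.1 (g v + v + w)) * ψ (b (g v) v + b (g v + v) w) := by
      intro Q w
      rw [← hψ.add, ← hψ.add, Q.2.2, Q.2.2]
      congr 1
      have : b (g v) v + b (g v) v = 0 := CharTwo.add_self_eq_zero _
      have h' : b (g v + v) w + b (g v + v) w = 0 := CharTwo.add_self_eq_zero _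
      linear_combination - this - h'
    simp only [h3, ← Finset.sum_mul, sum_psi_X hψ hb hnd, card_XT hψ hb hnd Q0]
    rw [Finset.sum_eq_single (g v + v)]
    · rw [if_pos (char2_add V F _), halt, add_zero]
    · intro w _ hw
      rw [if_neg, zero_mul]
      intro h
      apply hw
      have h5 : w + w = 0 := char2_add V F w
      exact (add_right_cancel (h.trans h5.symm)).symm
    · simp
  have h8 : ∑ Q : XT b, (∑ v, ψ (Q.1 (g v) + Q.1 v)) * gauss ψ Q.1 =
      Fintype.card V * ∑ v, ψ (b (g v) v) := by
    simp only [gauss, Finset.sum_mul_sum]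
    rw [Finset.sum_comm, Finset.mul_sum]
    apply Finset.sum_congr rfl
    intro v _
    rw [Finset.sum_comm, h2]
  have h7 : (Fintype.card V : ℤ) ≠ 0 := by
    have : 0 < Fintype.card V := Fintype.card_pos
    omega
  exact mul_left_cancel₀ h7 (h1.symm.trans h8)

theorem card_minus_fix (hψ : Psi ψ) (halt : ∀ v, b v v = 0) (hb : ∀ u v, b u v = b v u) (hnd : ∀ v, (∀ w, b v w = 0) → v = 0) (Q0 : XT b)
    (g : V ≃ₗ[F] V) (hg : ∀ u w, b (g u) (g w) = b u w) [DecidableEq V] [DecidableEq (XT b)]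
    (N : ℕ) (hN : N * N = Fintype.card V) :
    2 * N * ((univ.filter fun Q : XT b => Q.comp g hg = Q ∧ gauss ψ Q.1 = - N).card : ℤ) + ∑ v, ψ (b (g v) v) =
      N * (univ.filter fun v : V => g v = v).card := by
  rw [← sum_gauss_fix hψ halt hb hnd Q0 g hg, ← card_fix hψ halt hb hnd Q0 g hg,
    ← Finset.filter_filter, Finset.card_filter (fun Q : XT b => gauss ψ Q.1 = - N), Nat.cast_sum, Finset.mul_sum, ← Finset.sum_add_distrib]
  have hN0 : N ≠ 0 := by
    rintro rfl
    have : 0 < Fintype.card V := Fintype.card_pos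
    omega
  have h1 : ∀ Q : XT b, 2 * (N : ℤ) * ((if gauss ψ Q.1 = - N then 1 else 0 : ℕ) : ℤ) + gauss ψ Q.1 = N := by
    intro Q
    have h2 := gauss_sq hψ hb hnd Q
    rw [← hN] at h2
    push_cast at h2
    rcases mul_self_eq_mul_self_iff.1 h2 with h3 | h3
    · rw [if_neg (by omega), h3]; simp
    · rw [if_pos h3, h3]; push_cast; ring
  simp only [h1, Finset.sum_const, nsmul_eq_mul]
  ring
end


section
variable {F V : Type*} [Field F] [Fintype F] [CharP F 2] [AddCommGroup V] [Module F V]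
    [Fintype V] {b : LinearMap.BilinForm F V} {ψ : F → ℤ}

open Classical in
theorem sum_psi_sub (hψ : Psi ψ) (W : Submodule F V) (v : V) :
    ∑ w : W, ψ (b v w) = if ∀ w ∈ W, b v w = 0 then (Fintype.card W : ℤ) else 0 := by
  split_ifs with h
  · rw [Finset.sum_congr rfl (fun w _ => by rw [h w w.2, hψ.zero])]; simp
  · push Not at h
    obtain ⟨w, hw, hne⟩ := h
    obtain ⟨a, ha⟩ := hψ.nt
    apply sum_neg_equiv _ (Equiv.addRight (⟨(a / b v w) • w, W.smul_mem _ hw⟩ : W))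
    intro u
    simp only [Equiv.coe_addRight, Submodule.coe_add, map_add, map_smul, smul_eq_mul]
    rw [hψ.add, div_mul_cancel₀ _ hne, ha]; ring

open Classical in
theorem card_orth (hψ : Psi ψ) (hb : ∀ u v, b u v = b v u) (hnd : ∀ v, (∀ w, b v w = 0) → v = 0)
    (W W' : Submodule F V) (h : ∀ v, v ∈ W' ↔ ∀ w ∈ W, b v w = 0) :
    Fintype.card W' * Fintype.card W = Fintype.card V := by
  have h1 : ∑ v : V, ∑ w : W, ψ (b v w) = Fintype.card W' * Fintype.card W := by
    simp only [sum_psi_sub hψ, ← h]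
    rw [Finset.sum_ite, Finset.sum_const_zero, add_zero, Finset.sum_const, nsmul_eq_mul]
    congr 2
    rw [Fintype.card_subtype]
  rw [Finset.sum_comm] at h1
  simp only [sum_psi_b hψ hb hnd] at h1
  rw [Finset.sum_ite, Finset.sum_const_zero, add_zero, Finset.sum_const, nsmul_eq_mul] at h1
  have h2 : (univ.filter fun w : W => (w : V) = 0) = {0} := by
    ext w; simp
  rw [h2] at h1
  simp at h1
  exact_mod_cast h1.symm

theorem sum_psi_sq (hψ : Psi ψ) (d : F) (hd : d ≠ 0) : ∑ c : F, ψ (c * c * d) = 0 := by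
  obtain ⟨a, ha⟩ := hψ.nt
  obtain ⟨c, hc⟩ := FiniteField.isSquare_of_char_two (ringChar.eq F 2) (a / d)
  apply sum_neg_equiv _ (Equiv.addRight c)
  intro t
  simp only [Equiv.coe_addRight]
  have h1 : t * c + t * c = 0 := CharTwo.add_self_eq_zero _
  have h3 : a / d * d = a := div_mul_cancel₀ _ hd
  have : (t + c) * (t + c) * d = t * t * d + a := by
    linear_combination h1 * d - d * hc + h3
  rw [this, hψ.add, ha]; ring

open Classical in
theorem gauss_minus (hψ : Psi ψ) (halt : ∀ v, b v v = 0) (hb : ∀ u v, b u v = b v u)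
    (hnd : ∀ v, (∀ w, b v w = 0) → v = 0) (Q : XT b) (n : ℕ) (hn : 1 ≤ n)
    (hd : finrank F V = 2 * n) (W : Submodule F V) (hW : finrank F W = n - 1) (hWQ : ∀ w ∈ W, Q.1 w = 0)
    (hno : ¬ ∃ W : Submodule F V, finrank F W = n ∧ ∀ w ∈ W, Q.1 w = 0) :
    gauss ψ Q.1 = - ((Fintype.card F ^ n : ℕ) : ℤ) := by
  let W' : Submodule F V := 
    { carrier := {v | ∀ w ∈ W, b v w = 0}
      add_mem' := by intro u v hu hv w hw; simp [hu w hw, hv w hw]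
      zero_mem' := by intro w _; simp
      smul_mem' := by intro c u hu w hw; simp [hu w hw] }
  have hW' : ∀ v, v ∈ W' ↔ ∀ w ∈ W, b v w = 0 := fun v => Iff.rfl
  have hWW : W ≤ W' := by
    intro v hv w hw
    have := Q.2.2 v w
    rw [hWQ _ (W.add_mem hv hw), hWQ v hv, hWQ w hw] at this
    simpa using this.symm
  have hcW : Fintype.card W = Fintype.card F ^ (n - 1) := by rw [Module.card_eq_pow_finrank (K := F), hW]
  have hcV : Fintype.card V = Fintype.card F ^ (2 * n) := by rw [Module.card_eq_pow_finrank (K := F), hd]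
  have hq : 1 < Fintype.card F := Fintype.one_lt_card
  have hcW' : Fintype.card W' = Fintype.card F ^ (n + 1) := by
    have := card_orth hψ hb hnd W W' hW'
    rw [hcW, hcV, show 2 * n = (n + 1) + (n - 1) by omega, pow_add] at this
    exact Nat.eq_of_mul_eq_mul_right (pow_pos (by omega) _) this
  -- reduce to a smaller subspace
  have hS : gauss ψ Q.1 = ∑ v ∈ univ.filter (· ∈ W'), ψ (Q.1 v) := by
    have h1 : (Fintype.card W : ℤ) * gauss ψ Q.1 = ∑ w : W, ∑ v, ψ (Q.1 v) * ψ (b v w) := by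
      have h2 : ∀ w : W, ∑ v, ψ (Q.1 v) * ψ (b v w) = gauss ψ Q.1 := by
        intro w
        rw [gauss, ← Equiv.sum_comp (Equiv.addRight (w : V)) (fun v => ψ (Q.1 v))]
        apply Finset.sum_congr rfl
        intro v _
        simp only [Equiv.coe_addRight]
        rw [Q.2.2, hWQ w w.2, add_zero, hψ.add]
      simp only [h2]; simp
    rw [Finset.sum_comm] at h1
    simp only [← Finset.mul_sum, sum_psi_sub hψ, ← hW'] at h1
    rw [Finset.sum_filter]
    have h3 : (Fintype.card W : ℤ) ≠ 0 := by
      have : 0 < Fintype.card W := Fintype.card_pos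
      omega
    apply mul_left_cancel₀ h3
    rw [h1, Finset.mul_sum]
    apply Finset.sum_congr rfl
    intro v _
    split_ifs <;> ring
  have hne : ∀ v, v ∈ W' → v ∉ W → Q.1 v ≠ 0 := by
    intro v hv hvW h0
    apply hno
    refine ⟨W ⊔ Submodule.span F {v}, ?_, ?_⟩
    · have hv0 : v ≠ 0 := by rintro rfl; exact hvW (zero_mem _)
      have h1 := Submodule.finrank_sup_add_finrank_inf_eq W (Submodule.span F {v})
      have h2 : W ⊓ Submodule.span F {v} = ⊥ := by
        rw [eq_bot_iff]
        rintro u ⟨hu1, hu2⟩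
        obtain ⟨c, rfl⟩ := Submodule.mem_span_singleton.1 hu2
        by_cases hc : c = 0
        · simp [hc]
        · exfalso
          apply hvW
          have := W.smul_mem c⁻¹ hu1
          rwa [smul_smul, inv_mul_cancel₀ hc, one_smul] at this
      rw [h2, finrank_bot, finrank_span_singleton hv0, hW] at h1
      omega
    · intro u hu
      obtain ⟨w, hw, y, hy, rfl⟩ := Submodule.mem_sup.1 hu
      obtain ⟨c, rfl⟩ := Submodule.mem_span_singleton.1 hy
      rw [Q.2.2, hWQ w hw, Q.2.1, h0, map_smul, hb, hv w hw]; simp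
  set T := ∑ v ∈ univ.filter (fun v => v ∈ W' ∧ v ∉ W), ψ (Q.1 v) with hT
  have hsplit : gauss ψ Q.1 = Fintype.card W + T := by
    rw [hS, ← Finset.sum_filter_add_sum_filter_not _ (fun v => v ∈ W), Finset.filter_filter, Finset.filter_filter]
    congr 1
    rw [Finset.sum_congr rfl (g := fun _ => (1 : ℤ))]
    · rw [Finset.sum_const, Fintype.card_subtype]
      simp only [nsmul_eq_mul, mul_one]
      congr 2
      ext v
      simp only [Finset.mem_filter, Finset.mem_univ, true_and]
      exact ⟨fun h => h.2, fun h => ⟨hWW h, h⟩⟩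
    · intro v hv
      simp only [Finset.mem_filter, Finset.mem_univ, true_and] at hv
      rw [hWQ v hv.2, hψ.zero]
  have hcount : (univ.filter (fun v => v ∈ W' ∧ v ∉ W)).card + Fintype.card W = Fintype.card W' := by
    rw [Fintype.card_subtype, Fintype.card_subtype, ← Finset.card_filter_add_card_filter_not (s := univ.filter (· ∈ W')) (fun v => v ∈ W), Finset.filter_filter, Finset.filter_filter, add_comm]
    congr 2
    ext v
    simp only [Finset.mem_filter, Finset.mem_univ, true_and]
    exact ⟨fun h => ⟨hWW h, h⟩, fun h => h.2⟩
  have hTs : ((Fintype.card F : ℤ) - 1) * T = - (univ.filter (fun v => v ∈ W' ∧ v ∉ W)).card := by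
    have h1 : ∀ c ∈ (univ : Finset F).erase 0, ∑ v ∈ univ.filter (fun v => v ∈ W' ∧ v ∉ W), ψ (c * c * Q.1 v) = T := by
      intro c hc
      have hc0 : c ≠ 0 := by simpa using hc
      rw [hT]
      apply Finset.sum_bij (fun v _ => c • v)
      · intro v hv
        simp only [Finset.mem_filter, Finset.mem_univ, true_and] at hv ⊢
        exact ⟨W'.smul_mem c hv.1, fun h => hv.2 ((W.smul_mem_iff hc0).1 h)⟩
      · intro u _ v _ huv
        exact smul_right_injective V hc0 huv
      · intro v hv
        simp only [Finset.mem_filter, Finset.mem_univ, true_and] at hv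
        refine ⟨c⁻¹ • v, ?_, by rw [smul_smul, mul_inv_cancel₀ hc0, one_smul]⟩
        simp only [Finset.mem_filter, Finset.mem_univ, true_and]
        exact ⟨W'.smul_mem _ hv.1, fun h => hv.2 ((W.smul_mem_iff (inv_ne_zero hc0)).1 h)⟩
      · intro v _
        rw [Q.2.1]
    have h2 := Finset.sum_congr rfl h1
    rw [Finset.sum_const, Finset.card_erase_of_mem (Finset.mem_univ _), Finset.card_univ, nsmul_eq_mul,
      Nat.cast_sub (by omega), Finset.sum_comm] at h2
    push_cast at h2
    rw [← h2]
    rw [Finset.sum_congr rfl (g := fun _ => (-1 : ℤ))]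
    · simp
    · intro v hv
      simp only [Finset.mem_filter, Finset.mem_univ, true_and] at hv
      have h3 := sum_psi_sq hψ _ (hne v hv.1 hv.2)
      rw [← Finset.add_sum_erase _ _ (Finset.mem_univ (0 : F))] at h3
      simp only [zero_mul, hψ.zero] at h3
      linarith
  rw [hcW, hcW'] at hcount
  rw [hsplit, hcW]
  have hc2 : ((univ.filter (fun v => v ∈ W' ∧ v ∉ W)).card : ℤ) + (Fintype.card F : ℤ) ^ (n - 1) = (Fintype.card F : ℤ) ^ (n + 1) := by
    exact_mod_cast hcount
  obtain ⟨m, rfl⟩ : ∃ m, n = m + 1 := ⟨n - 1, by omega⟩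
  simp only [Nat.add_sub_cancel] at hc2 ⊢
  have hq1 : ((Fintype.card F : ℤ) - 1) ≠ 0 := by omega
  apply mul_left_cancel₀ hq1
  push_cast
  rw [mul_add, hTs]
  rw [show ((univ.filter (fun v => v ∈ W' ∧ v ∉ W)).card : ℤ) = (Fintype.card F : ℤ) ^ (m + 1 + 1) - (Fintype.card F : ℤ) ^ m by linarith]
  ring
end


theorem zeta_isUnit {A : Type*} [Fintype A] [DecidableEq A] [PartialOrder A]
    (Z : Matrix A A ℚ) (hZ : ∀ a c, (c ≤ a → Z a c = 1) ∧ (¬ c ≤ a → Z a c = 0)) : IsUnit Z := by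
  classical
  rw [← Matrix.mulVec_injective_iff_isUnit]
  have key : ∀ f : A → ℚ, Z.mulVec f = 0 → f = 0 := by
    intro f hf
    funext a
    induction a using WellFoundedLT.induction with
    | _ a ih =>
    have h1 := congrFun hf a
    simp only [Matrix.mulVec, dotProduct, Pi.zero_apply] at h1
    rw [Finset.sum_eq_single a, (hZ a a).1 le_rfl, one_mul] at h1
    · exact h1
    · intro c _ hc
      by_cases hca : c ≤ a
      · rw [ih c (lt_of_le_of_ne hca hc)]; simp
      · rw [(hZ a c).2 hca, zero_mul]
    · simp
  intro f g hfg
  have := key (f - g) (by rw [Matrix.mulVec_sub]; exact sub_eq_zero.2 hfg)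
  exact sub_eq_zero.1 this

section
variable {F V : Type*} [Field F] [Fintype F] [CharP F 2] [AddCommGroup V] [Module F V]
    [Fintype V] {b : LinearMap.BilinForm F V} {x : Module.End F V} {ψ : F → ℤ}

instance : Finite (V ≃ₗ[F] V) := Finite.of_injective (fun g => (g : V → V)) DFunLike.coe_injective

noncomputable instance : Fintype (Gx b x) := Fintype.ofFinite _

open Classical in
theorem trace_sum (hψ : Psi ψ) (hb : ∀ u v, b u v = b v u)
    (hnd : ∀ v, (∀ w, b v w = 0) → v = 0) (N : ℕ) (hN : N * N = Fintype.card V)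
    {A : Type*} [Fintype A] [PartialOrder A] (σ : A → A) (M : A → Submodule F V) (lab : V → A)
    (hsurj : Function.Surjective lab) (hlab : ∀ v c, v ∈ M c ↔ c ≤ lab v)
    (horb : ∀ v w, lab v = lab w ↔ ∃ g ∈ Gx b x, g v = w)
    (hσ : ∀ c v, v ∈ M (σ c) ↔ ∀ w ∈ M c, b v w = 0) :
    ∑ g : Gx b x, ∑ v, ψ (b (g.1 v) v) =
      Fintype.card (Gx b x) * (N * (univ.filter fun c => σ c = c).card) := by
  choose r hr using hsurj
  set K : A → A → ℤ := fun a a' => ∑ w ∈ univ.filter (fun w => lab w = a'), ψ (b (r a) w) with hK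
  have hlabg : ∀ (g : Gx b x) v, lab (g.1 v) = lab v := fun g v => ((horb _ _).2 ⟨g.1, g.2, rfl⟩).symm
  -- diagonal entries
  have hreindex : ∀ (g : Gx b x) a (φ : V → ℤ), ∑ w ∈ univ.filter (fun w => lab w = a), φ (g.1 w) =
      ∑ w ∈ univ.filter (fun w => lab w = a), φ w := by
    intro g a φ
    rw [Finset.sum_filter, Finset.sum_filter, ← Equiv.sum_comp g.1.toEquiv (fun w => if lab w = a then φ w else 0)]
    apply Finset.sum_congr rfl
    intro w _
    have : lab (g.1.toEquiv w) = lab w := hlabg g w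
    rw [this]; rfl
  have hdiag : ∀ a, ∑ v ∈ univ.filter (fun v => lab v = a), ∑ g : Gx b x, ψ (b (g.1 v) v) =
      Fintype.card (Gx b x) * K a a := by
    intro a
    have h1 : ∀ v, lab v = a → ∑ g : Gx b x, ψ (b (g.1 v) v) = ∑ g : Gx b x, ψ (b (g.1 (r a)) (r a)) := by
      intro v hv
      obtain ⟨h, hh, rfl⟩ := (horb (r a) v).1 ((hr a).trans hv.symm)
      rw [← Equiv.sum_comp (MulAut.conj (⟨h, hh⟩ : Gx b x)).toEquiv]
      apply Finset.sum_congr rfl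
      intro g _
      have : ((MulAut.conj (⟨h, hh⟩ : Gx b x)).toEquiv g).1 (h (r a)) = h (g.1 (r a)) := by
        show h (g.1 (h.symm (h (r a)))) = _
        rw [h.symm_apply_apply]
      rw [this, hh.1]
    have h2 : ∀ w, lab w = a → ∑ g : Gx b x, ψ (b (g.1 w) (r a)) = ∑ g : Gx b x, ψ (b (g.1 (r a)) (r a)) := by
      intro v hv
      obtain ⟨h, hh, rfl⟩ := (horb (r a) v).1 ((hr a).trans hv.symm)
      rw [← Equiv.sum_comp (Equiv.mulRight (⟨h, hh⟩ : Gx b x)) (fun g => ψ (b (g.1 (r a)) (r a)))]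
      rfl
    have h3 : Fintype.card (Gx b x) * K a a = ∑ g : Gx b x, ∑ w ∈ univ.filter (fun w => lab w = a), ψ (b (g.1 w) (r a)) := by
      have : ∀ g : Gx b x, ∑ w ∈ univ.filter (fun w => lab w = a), ψ (b (g.1 w) (r a)) = K a a := by
        intro g
        rw [hreindex g a (fun w => ψ (b w (r a)))]
        simp only [hK]
        apply Finset.sum_congr rfl
        intro w _
        rw [hb]
      simp only [this]; simp
    rw [h3, Finset.sum_comm (s := univ)]
    apply Finset.sum_congr rfl
    intro v hv
    have hv' : lab v = a := by simpa using hv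
    rw [h1 v hv', h2 v hv']
  have htr : ∑ g : Gx b x, ∑ v, ψ (b (g.1 v) v) = Fintype.card (Gx b x) * ∑ a, K a a := by
    rw [Finset.sum_comm, Finset.mul_sum, ← Finset.sum_fiberwise univ lab]
    exact Finset.sum_congr rfl fun a _ => hdiag a
  -- matrices
  set Km : Matrix A A ℚ := Matrix.of fun a a' => (K a a' : ℚ) with hKm
  set Z : Matrix A A ℚ := Matrix.of fun a c => if c ≤ a then 1 else 0 with hZ
  set P : Matrix A A ℚ := Matrix.of fun d c => if d = σ c then (Fintype.card (M c) : ℚ) else 0 with hP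
  have hZu : IsUnit Z := zeta_isUnit Z (fun a c => ⟨fun h => by simp [hZ, h], fun h => by simp [hZ, h]⟩)
  have hKZ : Km * Z = Z * P := by
    ext a c
    rw [Matrix.mul_apply, Matrix.mul_apply]
    have e1 : ∑ d, Z a d * P d c = if σ c ≤ a then (Fintype.card (M c) : ℚ) else 0 := by
      rw [Finset.sum_eq_single (σ c)]
      · simp [hZ, hP]
      · intro d _ hd; simp [hP, hd]
      · simp
    have e2 : ∑ a', K a a' * (if c ≤ a' then 1 else 0) = ∑ w : M c, ψ (b (r a) w) := by
      have e3 : ∀ a', K a a' * (if c ≤ a' then 1 else 0) =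
          ∑ w ∈ univ.filter (fun w => lab w = a'), if w ∈ M c then ψ (b (r a) w) else 0 := by
        intro a'
        simp only [hK, Finset.sum_mul]
        apply Finset.sum_congr rfl
        intro w hw
        have hw' : lab w = a' := by simpa using hw
        simp only [hlab, hw']
        split_ifs <;> simp
      simp only [e3]
      rw [Finset.sum_fiberwise univ lab (fun w => if w ∈ M c then ψ (b (r a) w) else 0), ← Finset.sum_filter]
      exact (Finset.sum_subtype _ (by simp) _)
    rw [e1]
    have e4 : ∑ j, Km a j * Z j c = ((∑ a', K a a' * (if c ≤ a' then 1 else 0) : ℤ) : ℚ) := by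
      push_cast; rfl
    rw [e4, e2, sum_psi_sub hψ]
    have e5 : (∀ w ∈ M c, b (r a) w = 0) ↔ σ c ≤ a := by rw [← hσ, hlab, hr]
    simp only [e5]
    split_ifs <;> simp
  have htrace : Matrix.trace Km = Matrix.trace P := by
    obtain ⟨u, hu⟩ := hZu
    rw [← hu] at hKZ
    have : Km = (u : Matrix A A ℚ) * P * ((u⁻¹ : (Matrix A A ℚ)ˣ) : Matrix A A ℚ) := by
      rw [← hKZ, mul_assoc, Units.mul_inv, mul_one]
    rw [this, Matrix.trace_mul_comm, ← mul_assoc, Units.inv_mul, one_mul]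
  have htrP : Matrix.trace P = N * (univ.filter fun c => σ c = c).card := by
    rw [Matrix.trace, Finset.card_filter]
    push_cast
    rw [Finset.mul_sum]
    apply Finset.sum_congr rfl
    intro c _
    simp only [Matrix.diag_apply, hP, Matrix.of_apply]
    by_cases hc : σ c = c
    · rw [if_pos hc.symm, if_pos hc, mul_one]
      have h1 := card_orth hψ hb hnd (M c) (M (σ c)) (hσ c)
      rw [hc, ← hN] at h1
      exact_mod_cast Nat.mul_self_inj.1 h1
    · rw [if_neg (fun h => hc h.symm), if_neg hc, mul_zero]
  have hfinal : ((∑ a, K a a : ℤ) : ℚ) = N * (univ.filter fun c => σ c = c).card := by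
    rw [← htrP, ← htrace]; push_cast; rfl
  rw [htr]
  congr 1
  exact_mod_cast hfinal

abbrev Xm (b : LinearMap.BilinForm F V) (ψ : F → ℤ) (N : ℕ) : Type _ := {Q : XT b // gauss ψ Q.1 = - (N : ℤ)}

noncomputable def xmAct (b : LinearMap.BilinForm F V) (x : Module.End F V) (ψ : F → ℤ) (N : ℕ) :
    MulAction (Gx b x) (Xm b ψ N) where
  smul g Q := ⟨Q.1.comp (g⁻¹).1 (g⁻¹).2.1, by rw [gauss_comp]; exact Q.2⟩
  one_smul Q := by
    apply Subtype.ext; apply Subtype.ext; funext v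
    rfl
  mul_smul g h Q := by
    apply Subtype.ext; apply Subtype.ext; funext v
    rfl

def xmRel (b : LinearMap.BilinForm F V) (x : Module.End F V) (ψ : F → ℤ) (N : ℕ) (Q Q' : Xm b ψ N) : Prop :=
  ∃ g ∈ Gx b x, ∀ v, Q'.1.1 v = Q.1.1 (g v)

open Classical in
theorem count_orbits (hψ : Psi ψ) (halt : ∀ v, b v v = 0) (hb : ∀ u v, b u v = b v u)
    (hnd : ∀ v, (∀ w, b v w = 0) → v = 0) (N : ℕ) (hN : N * N = Fintype.card V) (Q0 : XT b)
    {A : Type*} [Fintype A] [PartialOrder A] (σ : A → A) (M : A → Submodule F V) (lab : V → A)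
    (hsurj : Function.Surjective lab) (hlab : ∀ v c, v ∈ M c ↔ c ≤ lab v)
    (horb : ∀ v w, lab v = lab w ↔ ∃ g ∈ Gx b x, g v = w)
    (hσ : ∀ c v, v ∈ M (σ c) ↔ ∀ w ∈ M c, b v w = 0) :
    2 * Nat.card (Quot (xmRel b x ψ N)) + (univ.filter fun c => σ c = c).card = Fintype.card A := by
  letI := xmAct b x ψ N
  have hsmul : ∀ (g : Gx b x) (Q : Xm b ψ N) v, (g • Q).1.1 v = Q.1.1 ((g⁻¹).1 v) := fun _ _ _ => rfl
  have hB1 := MulAction.sum_card_fixedBy_eq_card_orbits_mul_card_group (Gx b x) (Xm b ψ N)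
  have hB2 := MulAction.sum_card_fixedBy_eq_card_orbits_mul_card_group (Gx b x) V
  have hq1 : Nat.card (Quot (xmRel b x ψ N)) = Fintype.card (Quotient (MulAction.orbitRel (Gx b x) (Xm b ψ N))) := by
    rw [← Nat.card_eq_fintype_card]
    apply Nat.card_congr
    apply Quot.congrRight
    intro Q Q'
    show _ ↔ Q ∈ MulAction.orbit _ _
    constructor
    · rintro ⟨g, hg, h⟩
      refine ⟨⟨g, hg⟩, ?_⟩
      apply Subtype.ext; apply Subtype.ext; funext v
      show Q'.1.1 (g.symm v) = _
      rw [h, g.apply_symm_apply]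
    · rintro ⟨g, rfl⟩
      refine ⟨g.1, g.2, fun v => ?_⟩
      show _ = Q'.1.1 (g.1.symm (g.1 v))
      rw [g.1.symm_apply_apply]
  have hq2 : Fintype.card (Quotient (MulAction.orbitRel (Gx b x) V)) = Fintype.card A := by
    apply Fintype.card_congr
    refine Equiv.ofBijective (Quotient.lift lab ?_) ⟨?_, ?_⟩
    · rintro v w ⟨g, rfl⟩
      exact ((horb _ _).2 ⟨g.1, g.2, rfl⟩).symm
    · intro v w
      induction v using Quotient.inductionOn with | _ v =>
      induction w using Quotient.inductionOn with | _ w =>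
      intro h
      obtain ⟨g, hg, rfl⟩ := (horb _ _).1 h
      apply Quotient.sound
      exact (MulAction.orbitRel (Gx b x) V).symm ⟨⟨g, hg⟩, rfl⟩
    · intro a
      obtain ⟨v, rfl⟩ := hsurj a
      exact ⟨Quotient.mk _ v, rfl⟩
  have hf1 : ∀ g : Gx b x, Fintype.card (MulAction.fixedBy (Xm b ψ N) g) =
      (univ.filter fun Q : XT b => Q.comp g.1 g.2.1 = Q ∧ gauss ψ Q.1 = - N).card := by
    intro g
    rw [← Fintype.card_subtype]
    apply Fintype.card_congr
    have hiff : ∀ Q : Xm b ψ N, g • Q = Q ↔ Q.1.comp g.1 g.2.1 = Q.1 := by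
      intro Q
      constructor
      · intro h
        apply Subtype.ext; funext v
        show Q.1.1 (g.1 v) = _
        conv_lhs => rw [← h]
        show Q.1.1 (g.1.symm (g.1 v)) = _
        rw [g.1.symm_apply_apply]
      · intro h
        apply Subtype.ext; apply Subtype.ext; funext v
        show Q.1.1 (g.1.symm v) = _
        conv_lhs => rw [← h]
        show Q.1.1 (g.1 (g.1.symm v)) = _
        rw [g.1.apply_symm_apply]
    exact
      { toFun := fun Q => ⟨Q.1.1, (hiff _).1 Q.2, Q.1.2⟩
        invFun := fun Q => ⟨⟨Q.1, Q.2.2⟩, (hiff _).2 Q.2.1⟩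
        left_inv := fun _ => rfl
        right_inv := fun _ => rfl }
  have hf2 : ∀ g : Gx b x, Fintype.card (MulAction.fixedBy V g) = (univ.filter fun v : V => g.1 v = v).card := by
    intro g
    rw [← Fintype.card_subtype]
    apply Fintype.card_congr
    exact Equiv.refl _
  have hS := trace_sum (x := x) hψ hb hnd N hN σ M lab hsurj hlab horb hσ
  have hg : ∀ g : Gx b x, 2 * (N : ℤ) * (Fintype.card (MulAction.fixedBy (Xm b ψ N) g) : ℤ) + ∑ v, ψ (b (g.1 v) v) =
      N * (Fintype.card (MulAction.fixedBy V g) : ℤ) := by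
    intro g
    rw [hf1, hf2]
    exact card_minus_fix hψ halt hb hnd Q0 g.1 g.2.1 N hN
  have hsum := Finset.sum_congr (rfl : (univ : Finset (Gx b x)) = univ) (fun g _ => hg g)
  rw [Finset.sum_add_distrib, ← Finset.mul_sum, ← Finset.mul_sum, hS, ← Nat.cast_sum, ← Nat.cast_sum, hB1, hB2, hq2, ← hq1] at hsum
  have hN0 : (N : ℤ) ≠ 0 := by
    rintro h
    have : 0 < Fintype.card V := Fintype.card_pos
    have h' : N = 0 := by exact_mod_cast h
    rw [h'] at hN
    omega
  have hG0 : (Fintype.card (Gx b x) : ℤ) ≠ 0 := by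
    have : 0 < Fintype.card (Gx b x) := Fintype.card_pos
    omega
  push_cast at hsum
  have : (2 * (Nat.card (Quot (xmRel b x ψ N)) : ℤ) + (univ.filter fun c => σ c = c).card) = Fintype.card A := by
    apply mul_left_cancel₀ (mul_ne_zero hN0 hG0)
    linear_combination hsum
  exact_mod_cast this
end


section
variable {F V : Type*} [Field F] [CharP F 2] [AddCommGroup V] [Module F V]
    [FiniteDimensional F V]
    {b : LinearMap.BilinForm F V} {x : Module.End F V}

def jshift (n : ℕ) (lam : ℕ → ℕ) (j : ℕ) : JIdx n (fun i => lam i - j) → JIdx n lam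
  | Sum.inl ⟨i, k⟩ => Sum.inl ⟨i, ⟨k + j, by have := k.2; dsimp only at this; omega⟩⟩
  | Sum.inr ⟨i, k⟩ => Sum.inr ⟨i, ⟨k + j, by have := k.2; dsimp only at this; omega⟩⟩

theorem jshift_inj (n : ℕ) (lam : ℕ → ℕ) (j : ℕ) : Function.Injective (jshift n lam j) := by
  rintro (⟨i, k⟩ | ⟨i, k⟩) (⟨i', k'⟩ | ⟨i', k'⟩) h <;> simp only [jshift, Sum.inl.injEq, Sum.inr.injEq,
    Sigma.mk.injEq, reduceCtorEq] at h ⊢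
  all_goals
    obtain ⟨rfl, h⟩ := h
    simp only [heq_eq_eq, Fin.mk.injEq, true_and] at h ⊢
    exact Fin.ext (by omega)

theorem JS.finrank_range {lam : ℕ → ℕ} {e f : ℕ → V} (hb : ∀ u v, b u v = b v u) (J : JS b x lam e f) (n : ℕ)
    (hs : ∑ i ∈ range n, lam i = n) (hd : finrank F V = 2 * n) (j : ℕ) :
    finrank F (LinearMap.range (x ^ j)) = 2 * ∑ i ∈ range n, (lam i - j) := by
  have h1 : LinearMap.range (x ^ j) =
      Submodule.span F (Set.range (jvec n x lam e f ∘ jshift n lam j)) := by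
    apply le_antisymm
    · rintro _ ⟨v, rfl⟩
      rw [J.expand hb n hs hd v, map_sum]
      apply Submodule.sum_mem
      intro s _
      rw [map_smul]
      apply Submodule.smul_mem
      rcases s with ⟨i, k⟩ | ⟨i, k⟩
      · have e1 : (x ^ j) (jvec n x lam e f (Sum.inl ⟨i, k⟩)) = (x ^ ((k : ℕ) + j)) (e i) := by
          rw [add_comm, pow_add]; rfl
        rw [e1]
        by_cases hk : (k : ℕ) + j < lam i
        · apply Submodule.subset_span
          exact ⟨Sum.inl ⟨i, ⟨k, by dsimp only; omega⟩⟩, rfl⟩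
        · rw [pow_kill J.xe (by omega)]
          exact Submodule.zero_mem _
      · have e1 : (x ^ j) (jvec n x lam e f (Sum.inr ⟨i, k⟩)) = (x ^ ((k : ℕ) + j)) (f i) := by
          rw [add_comm, pow_add]; rfl
        rw [e1]
        by_cases hk : (k : ℕ) + j < lam i
        · apply Submodule.subset_span
          exact ⟨Sum.inr ⟨i, ⟨k, by dsimp only; omega⟩⟩, rfl⟩
        · rw [pow_kill J.xf (by omega)]
          exact Submodule.zero_mem _
    · rw [Submodule.span_le]
      rintro _ ⟨s, rfl⟩
      rcases s with ⟨i, k⟩ | ⟨i, k⟩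
      · refine ⟨(x ^ (k : ℕ)) (e i), ?_⟩
        show _ = (x ^ ((k : ℕ) + j)) (e i)
        rw [add_comm, pow_add]; rfl
      · refine ⟨(x ^ (k : ℕ)) (f i), ?_⟩
        show _ = (x ^ ((k : ℕ) + j)) (f i)
        rw [add_comm, pow_add]; rfl
  rw [h1, finrank_span_eq_card ((J.linInd hb n).comp _ (jshift_inj n lam j)),
    Fintype.card_sum, Fintype.card_sigma]
  simp only [Fintype.card_fin]
  rw [Fin.sum_univ_eq_sum_range (fun i => lam i - j)]; ring

theorem antitone_eq_of_sums {n : ℕ} {lam mu : ℕ → ℕ} (h1 : Antitone lam) (h2 : Antitone mu)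
    (z1 : ∀ i, n ≤ i → lam i = 0) (z2 : ∀ i, n ≤ i → mu i = 0)
    (h : ∀ j, ∑ i ∈ range n, (lam i - j) = ∑ i ∈ range n, (mu i - j)) : lam = mu := by
  have key : ∀ nu : ℕ → ℕ, Antitone nu → (∀ i, n ≤ i → nu i = 0) → ∀ i j,
      (j < nu i ↔ i < ∑ i ∈ range n, (nu i - j) - ∑ i ∈ range n, (nu i - (j + 1))) := by
    intro nu hnu hz i j
    have e1 : ∑ i ∈ range n, (nu i - j) = ∑ i ∈ range n, (nu i - (j + 1)) +
        ((range n).filter (fun i => j < nu i)).card := by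
      rw [Finset.card_filter, ← Finset.sum_add_distrib]
      apply Finset.sum_congr rfl
      intro i _
      split_ifs <;> omega
    rw [e1, Nat.add_sub_cancel_left]
    constructor
    · intro hj
      have : range (i + 1) ⊆ (range n).filter (fun i => j < nu i) := by
        intro k hk
        rw [Finset.mem_range] at hk
        have := hnu (show k ≤ i by omega)
        rw [Finset.mem_filter, Finset.mem_range]
        refine ⟨?_, by omega⟩
        by_contra hkn
        have := hz k (by omega)
        omega
      have := Finset.card_le_card this
      rw [Finset.card_range] at this
      omega
    · intro hc
      by_contra hj
      have : (range n).filter (fun i => j < nu i) ⊆ range i := by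
        intro k hk
        rw [Finset.mem_filter] at hk
        rw [Finset.mem_range]
        by_contra hki
        have := hnu (show i ≤ k by omega)
        omega
      have := Finset.card_le_card this
      rw [Finset.card_range] at this
      omega
  funext i
  have h3 : ∀ j, j < lam i ↔ j < mu i := by
    intro j
    rw [key lam h1 z1, key mu h2 z2, h, h]
  have h4 := h3 (lam i)
  have h5 := h3 (mu i)
  omega

theorem JS.shape_unique {x' : Module.End F V} {lam mu : ℕ → ℕ} {e f e' f' : ℕ → V} (hb : ∀ u v, b u v = b v u)
    (J : JS b x lam e f) (J' : JS b x' mu e' f') (n : ℕ)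
    (h1 : Antitone lam) (h2 : Antitone mu)
    (z1 : ∀ i, n ≤ i → lam i = 0) (z2 : ∀ i, n ≤ i → mu i = 0)
    (hs : ∑ i ∈ range n, lam i = n) (hs' : ∑ i ∈ range n, mu i = n) (hd : finrank F V = 2 * n)
    (g : V ≃ₗ[F] V) (hg : ∀ u, g (x u) = x' (g u)) : lam = mu := by
  apply antitone_eq_of_sums h1 h2 z1 z2
  intro j
  have e1 := J.finrank_range hb n hs hd j
  have e2 := J'.finrank_range hb n hs' hd j
  have hgj : ∀ u, g ((x ^ j) u) = (x' ^ j) (g u) := by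
    intro u
    induction j with
    | zero => rfl
    | succ j ih =>
      rw [pow_succ', pow_succ']
      simp only [Module.End.mul_apply]
      rw [hg, ih (J.finrank_range hb n hs hd j) (J'.finrank_range hb n hs' hd j)]
  have e3 : (LinearMap.range (x ^ j)).map (g : V →ₗ[F] V) = LinearMap.range (x' ^ j) := by
    ext v
    simp only [Submodule.mem_map, LinearMap.mem_range]
    constructor
    · rintro ⟨_, ⟨u, rfl⟩, rfl⟩
      exact ⟨g u, (hgj u).symm⟩
    · rintro ⟨u, rfl⟩
      exact ⟨_, ⟨g.symm u, rfl⟩, by simp [hgj]⟩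
  have e4 := LinearEquiv.finrank_map_eq g (LinearMap.range (x ^ j))
  rw [e3] at e4
  omega

/-- shapes: partitions of `n` as padded antitone sequences. -/
def Shape (n k : ℕ) : Type :=
  {lam : ℕ → ℕ // Antitone lam ∧ (∀ i, n ≤ i → lam i = 0) ∧ ∑ i ∈ range n, lam i = k}

theorem SN.exists_shape' (h : SN b x) {n : ℕ} (hd : finrank F V = 2 * n) :
    ∃ (lam : Shape n n) (e f : ℕ → V), JS b x lam.1 e f := by
  obtain ⟨r, lam, e, f, h1, h2, h3, h4, J⟩ := SN.exists_JS (F := F) _ V b x h hd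
  have hr : r ≤ n := by
    have : ∑ i ∈ range r, 1 ≤ ∑ i ∈ range r, lam i :=
      Finset.sum_le_sum (fun i hi => h3 i (Finset.mem_range.1 hi))
    simp at this
    omega
  refine ⟨⟨lam, h1, fun i hi => h2 i (by omega), ?_⟩, e, f, J⟩
  rw [← Finset.sum_subset (Finset.range_subset_range.2 hr)]
  · omega
  · intro i _ hi
    exact h2 i (by simpa using hi)

end


section
variable {F V : Type*} [Field F] [CharP F 2] [AddCommGroup V] [Module F V]
    [FiniteDimensional F V]

theorem polar_alt (Q : QuadraticForm F V) (v : V) : QuadraticMap.polarBilin Q v v = 0 := by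
  rw [QuadraticMap.polarBilin_apply_apply, QuadraticMap.polar_self, two_nsmul]
  exact char2_add F F _

theorem polar_nd (Q : QuadraticForm F V) {n : ℕ} (hn : 1 ≤ n) (hdim : Module.finrank F V = 2 * n)
    (hQ : Q.IsNondegenerateFormSpace) :
    ∀ v, (∀ w, QuadraticMap.polarBilin Q v w = 0) → v = 0 := by
  obtain ⟨C, hC⟩ := Submodule.exists_isCompl Q.polarRadical
  have hfr := Submodule.finrank_add_eq_of_isCompl hC
  have hle := hQ.2.1
  have hmem : ∀ v, v ∈ Q.polarRadical ↔ ∀ w, QuadraticMap.polarBilin Q v w = 0 := by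
    intro v
    rw [QuadraticForm.polarRadical, LinearMap.mem_ker]
    exact ⟨fun h w => by rw [h]; rfl, fun h => LinearMap.ext h⟩
  have hsymm : ∀ u v, QuadraticMap.polarBilin Q u v = QuadraticMap.polarBilin Q v u := by
    intro u v
    simp only [QuadraticMap.polarBilin_apply_apply]
    exact QuadraticMap.polar_comm Q u v
  have hSN : SN (LinearMap.BilinForm.restrict (QuadraticMap.polarBilin Q) C) (0 : Module.End F C) := by
    refine ⟨fun v => polar_alt Q v, fun v hv => ?_, fun v => by simp, ⟨1, by simp⟩⟩
    have : (v : V) ∈ Q.polarRadical := by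
      rw [hmem]
      intro w
      have hw : w ∈ Q.polarRadical ⊔ C := by rw [hC.sup_eq_top]; trivial
      obtain ⟨r, hr, c, hc, rfl⟩ := Submodule.mem_sup.1 hw
      rw [map_add, hsymm v r, (hmem r).1 hr, zero_add]
      exact hv ⟨c, hc⟩
    have h0 : (v : V) ∈ Q.polarRadical ⊓ C := ⟨this, v.2⟩
    rw [hC.inf_eq_bot, Submodule.mem_bot] at h0
    exact Subtype.ext h0
  obtain ⟨r, lam, e, f, -, -, -, h4, -⟩ := SN.exists_JS (F := F) _ C _ _ hSN rfl
  have hz : finrank F Q.polarRadical = 0 := by omega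
  rw [Submodule.finrank_eq_zero] at hz
  intro v hv
  have := (hmem v).2 hv
  rw [hz] at this
  simpa using this

theorem mem_iff_SN (Q : QuadraticForm F V) 
    (hnd : ∀ v, (∀ w, QuadraticMap.polarBilin Q v w = 0) → v = 0) (x : Module.End F V) :
    (Q.mem_oLie x ∧ IsNilpotent x) ↔ SN (QuadraticMap.polarBilin Q) x := by
  constructor
  · rintro ⟨⟨h1, -⟩, h2⟩
    exact ⟨polar_alt Q, hnd, h1, h2⟩
  · intro h
    refine ⟨⟨h.sa, ?_⟩, h.nil⟩
    exact (LinearMap.isNilpotent_trace_of_isNilpotent h.nil).eq_zero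

end

theorem card_eq_of_surj {T A B : Type*} (p : T → A) (q : T → B) (hp : Function.Surjective p)
    (hq : Function.Surjective q) (h : ∀ s t, p s = p t ↔ q s = q t) : Nat.card A = Nat.card B := by
  have hk : Setoid.ker p = Setoid.ker q := Setoid.ext fun s t => h s t
  rw [← Nat.card_congr (Setoid.quotientKerEquivOfSurjective p hp),
    ← Nat.card_congr (Setoid.quotientKerEquivOfSurjective q hq), hk]

section
variable {F V : Type*} [Field F] [Fintype F] [CharP F 2] [AddCommGroup V] [Module F V]
    [Fintype V] {b : LinearMap.BilinForm F V} {x : Module.End F V} {ψ : F → ℤ}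

theorem xmRel_equiv (N : ℕ) : Equivalence (xmRel b x ψ N) := by
  refine ⟨fun Q => ⟨1, (Gx b x).one_mem, fun v => rfl⟩, ?_, ?_⟩
  · rintro Q Q' ⟨g, hg, h⟩
    refine ⟨g⁻¹, (Gx b x).inv_mem hg, fun v => ?_⟩
    rw [h]
    exact congrArg Q.1.1 (g.apply_symm_apply v).symm
  · rintro Q Q' Q'' ⟨g, hg, h⟩ ⟨g', hg', h'⟩
    refine ⟨g * g', (Gx b x).mul_mem hg hg', fun v => ?_⟩
    rw [h', h]; rfl

/-- the shape `1^n`. -/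
def oneShape (n : ℕ) : Shape n n :=
  ⟨fun i => if i < n then 1 else 0, by
    intro i j h
    dsimp only
    split_ifs <;> omega, fun i hi => by simp; omega, by
    rw [Finset.sum_ite_of_true (by simp)]; simp⟩

open Classical in
theorem count_shape (hψ : Psi ψ) (hb : ∀ u v, b u v = b v u) {n : ℕ} (hd : finrank F V = 2 * n)
    (Q0 : XT b) (h : SN b x) (lam : Shape n n) {e f : ℕ → V} (J : JS b x lam.1 e f) :
    2 * Nat.card (Quot (xmRel b x ψ (Fintype.card F ^ n))) + Nat.card {a : Aset lam.1 // a.sig = a} =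
      Nat.card (Aset lam.1) := by
  obtain ⟨M, lab, h1, h2, h3, h4⟩ := exists_lab h J lam.2.1 lam.2.2.1 lam.2.2.2 hd
  have : Finite (Aset lam.1) := Aset.finite lam.2.2.1
  have : Fintype (Aset lam.1) := Fintype.ofFinite _
  have hN : Fintype.card F ^ n * Fintype.card F ^ n = Fintype.card V := by
    rw [Module.card_eq_pow_finrank (K := F) (V := V), hd, two_mul, pow_add]
  have := count_orbits hψ h.alt hb h.nd _ hN Q0 Aset.sig M lab h1 h2 h3 h4
  rw [Nat.card_eq_fintype_card (α := Aset lam.1), ← this,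
    Nat.card_eq_fintype_card (α := {a : Aset lam.1 // a.sig = a}), Fintype.card_subtype]

theorem sp_transitive (hψ : Psi ψ) (halt : ∀ v, b v v = 0) (hb : ∀ u v, b u v = b v u)
    (hnd : ∀ v, (∀ w, b v w = 0) → v = 0) {n : ℕ} (hn : 1 ≤ n) (hd : finrank F V = 2 * n)
    (Q Q' : Xm b ψ (Fintype.card F ^ n)) :
    ∃ g : V ≃ₗ[F] V, (∀ u w, b (g u) (g w) = b u w) ∧ ∀ v, Q'.1.1 v = Q.1.1 (g v) := by
  obtain ⟨x, e, f, h, J⟩ := exists_shape n halt hnd hd (oneShape n).1 (oneShape n).2.2.1 (oneShape n).2.2.2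
  have h1 := count_shape hψ hb hd Q.1 h (oneShape n) J
  have h2 : Nat.card (Aset (oneShape n).1) ≤ 2 := by
    let φ : Aset (oneShape n).1 → Fin 2 := fun a => ⟨a.1 0, by
      have := a.2.2.1 0
      simp only [oneShape] at this
      split_ifs at this <;> omega⟩
    have hφ : Function.Injective φ := by
      intro a c hac
      have hac : a.1 0 = c.1 0 := Fin.ext_iff.1 hac
      have key : ∀ d : Aset (oneShape n).1, ∀ i, d.1 i = if i < n then d.1 0 else 0 := by
        intro d i
        have k1 := d.2.1 (Nat.zero_le i)
        have k2 := d.2.2.2 (Nat.zero_le i)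
        have k3 := d.2.2.1 i
        have k4 := d.2.2.1 0
        simp only [oneShape] at k1 k2 k3 k4
        split_ifs at * <;> omega
      apply Subtype.ext
      funext i
      rw [key a, key c, hac]
    have := Nat.card_le_card_of_injective φ hφ
    simpa using this
  have h3 : Nat.card (Quot (xmRel b x ψ (Fintype.card F ^ n))) ≤ 1 := by omega
  have : Finite (Quot (xmRel b x ψ (Fintype.card F ^ n))) := Quot.finite _
  rw [Finite.card_le_one_iff_subsingleton] at h3
  have h4 : Quot.mk (xmRel b x ψ (Fintype.card F ^ n)) Q = Quot.mk _ Q' := Subsingleton.elim _ _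
  obtain ⟨g, hg, h5⟩ := ((xmRel_equiv _).quot_mk_eq_iff _ _).1 h4
  exact ⟨g, hg.1, h5⟩
end

section
variable {F V : Type*} [Field F] [Fintype F] [CharP F 2] [AddCommGroup V] [Module F V]
    [Fintype V]

theorem OConj_equiv (Q : QuadraticForm F V) {P : Module.End F V → Prop} :
    Equivalence (fun x y : {x : Module.End F V // P x} => Q.OConj x.1 y.1) := by
  refine ⟨fun x => ⟨LinearEquiv.refl F V, fun v => rfl, rfl⟩, ?_, ?_⟩
  · rintro x y ⟨g, hg, h⟩
    refine ⟨g.symm, fun v => by rw [← hg, g.apply_symm_apply], ?_⟩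
    rw [h]
    ext v
    simp
  · rintro x y z ⟨g, hg, h⟩ ⟨g', hg', h'⟩
    refine ⟨g.trans g', fun v => by simp [hg, hg'], ?_⟩
    rw [h', h]
    ext v
    simp

/-- transport of `SN` along an isometry. -/
theorem SN.transport {b : LinearMap.BilinForm F V} {x : Module.End F V} (h : SN b x) (g : V ≃ₗ[F] V)
    (hg : ∀ u w, b (g u) (g w) = b u w) : SN b (g.toLinearMap ∘ₗ x ∘ₗ g.symm.toLinearMap) := by
  refine ⟨h.alt, h.nd, fun v => ?_, ?_⟩
  · have := h.sa (g.symm v)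
    rw [← hg, g.apply_symm_apply] at this
    exact this
  · obtain ⟨k, hk⟩ := h.nil
    refine ⟨k, ?_⟩
    have : ∀ m : ℕ, (g.toLinearMap ∘ₗ x ∘ₗ g.symm.toLinearMap) ^ m =
        g.toLinearMap ∘ₗ (x ^ m) ∘ₗ g.symm.toLinearMap := by
      intro m
      induction m with
      | zero => ext v; simp
      | succ m ih =>
        rw [pow_succ, ih, pow_succ]
        ext v
        simp [Module.End.mul_apply]
    rw [this, hk]
    ext v; simp

theorem orbits_sum (n : ℕ) (hn : 1 ≤ n) (Q : QuadraticForm F V)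
    (hdim : Module.finrank F V = 2 * n)
    (hQ : Q.IsNondegenerateFormSpace)
    (hWitt : Q.HasTotallySingularSubspace (n - 1))
    (hWitt' : ¬ Q.HasTotallySingularSubspace n) [Fintype (Shape n n)] :
    2 * Q.numNilpotentOOrbits + ∑ lam : Shape n n, Nat.card {a : Aset lam.1 // a.sig = a} =
      ∑ lam : Shape n n, Nat.card (Aset lam.1) := by
  classical
  obtain ⟨ψ, hψ⟩ := exists_psi F
  set b := QuadraticMap.polarBilin Q with hbdef
  have halt : ∀ v, b v v = 0 := polar_alt Q
  have hnd : ∀ v, (∀ w, b v w = 0) → v = 0 := polar_nd Q hn hdim hQ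
  have hb : ∀ u v, b u v = b v u := by
    intro u v
    simp only [hbdef, QuadraticMap.polarBilin_apply_apply]
    exact QuadraticMap.polar_comm Q u v
  let QT : XT b := ⟨fun v => Q v, fun c v => QuadraticMap.map_smul Q c v, fun u w => by
    simp only [hbdef, QuadraticMap.polarBilin_apply_apply, QuadraticMap.polar]
    ring⟩
  obtain ⟨W, hW, hWQ⟩ := hWitt
  let Q0 : Xm b ψ (Fintype.card F ^ n) := ⟨QT, gauss_minus hψ halt hb hnd QT n hn hdim W hW hWQ hWitt'⟩
  choose X E Fv hX hJ using fun lam : Shape n n => exists_shape (F := F) (V := V) n halt hnd hdim lam.1 lam.2.2.1 lam.2.2.2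
  have hcard : Q.numNilpotentOOrbits =
      Nat.card (Σ lam : Shape n n, Quot (xmRel b (X lam) ψ (Fintype.card F ^ n))) := by
    let T := Shape n n × {g : V ≃ₗ[F] V // ∀ u w, b (g u) (g w) = b u w}
    let S := {x : Module.End F V // Q.mem_oLie x ∧ IsNilpotent x}
    let R : S → S → Prop := fun x y => Q.OConj x.1 y.1
    have hR : Equivalence R := OConj_equiv Q
    let y : T → S := fun t => ⟨t.2.1.toLinearMap ∘ₗ X t.1 ∘ₗ t.2.1.symm.toLinearMap,
      (mem_iff_SN Q hnd _).2 ((hX t.1).transport t.2.1 t.2.2)⟩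
    let z : T → Xm b ψ (Fintype.card F ^ n) := fun t =>
      ⟨Q0.1.comp t.2.1 t.2.2, by rw [gauss_comp]; exact Q0.2⟩
    have hz : ∀ t v, (z t).1.1 v = Q (t.2.1 v) := fun t v => rfl
    show Nat.card (Quot R) = _
    apply card_eq_of_surj (T := T) (fun t => Quot.mk R (y t)) (fun t => ⟨t.1, Quot.mk _ (z t)⟩)
    · intro u
      induction u using Quot.ind with | _ x =>
      have hx := (mem_iff_SN Q hnd x.1).1 x.2
      obtain ⟨lam, e, f, J⟩ := hx.exists_shape' hdim
      obtain ⟨g, hg, hgx⟩ := (hJ lam).conj hb hb J n lam.2.2.2 hdim hdim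
      refine ⟨(lam, ⟨g, hg⟩), ?_⟩
      apply congrArg (Quot.mk R)
      apply Subtype.ext
      ext v
      show g (X lam (g.symm v)) = x.1 v
      rw [hgx, g.apply_symm_apply]
    · rintro ⟨lam, u⟩
      induction u using Quot.ind with | _ Q' =>
      obtain ⟨g, hg, hgQ⟩ := sp_transitive hψ halt hb hnd hn hdim Q0 Q'
      refine ⟨(lam, ⟨g, hg⟩), ?_⟩
      have : z (lam, ⟨g, hg⟩) = Q' := by
        apply Subtype.ext; apply Subtype.ext; funext v
        exact (hgQ v).symm
      exact congrArg (fun q => (⟨lam, Quot.mk _ q⟩ : Σ lam : Shape n n, Quot (xmRel b (X lam) ψ (Fintype.card F ^ n)))) this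
    · rintro ⟨lam, g, hg⟩ ⟨mu, g', hg'⟩
      rw [hR.quot_mk_eq_iff]
      constructor
      · rintro ⟨k, hk, h⟩
        have h1 : ∀ v, g' (X mu (g'.symm v)) = k (g (X lam (g.symm (k.symm v)))) := fun v =>
          LinearMap.congr_fun h v
        have h2 : ∀ u, (g.trans (k.trans g'.symm)) (X lam u) = X mu ((g.trans (k.trans g'.symm)) u) := by
          intro u
          have := h1 (k (g u))
          simp only [LinearEquiv.symm_apply_apply] at this
          simp only [LinearEquiv.trans_apply]
          rw [← this, LinearEquiv.symm_apply_apply]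
        have h3 : lam = mu := Subtype.ext ((hJ lam).shape_unique hb (hJ mu) n lam.2.1 mu.2.1 lam.2.2.1
          mu.2.2.1 lam.2.2.2 mu.2.2.2 hdim _ h2)
        subst h3
        have hkb : ∀ u w, b (k u) (k w) = b u w := by
          intro u w
          simp only [hbdef, QuadraticMap.polarBilin_apply_apply, QuadraticMap.polar, ← map_add, hk]
        have h4 : Quot.mk (xmRel b (X lam) ψ (Fintype.card F ^ n)) (z (lam, ⟨g', hg'⟩)) =
            Quot.mk _ (z (lam, ⟨g, hg⟩)) := by
          apply Quot.sound
          refine ⟨g.trans (k.trans g'.symm), ⟨?_, h2⟩, ?_⟩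
          · intro u w
            rw [← hg']
            simp [hkb, hg]
          · intro v
            rw [hz, hz]
            simp [hk]
        exact congrArg (Sigma.mk lam) h4.symm
      · intro h
        have h3 : lam = mu := congrArg Sigma.fst h
        subst h3
        have h4 : Quot.mk (xmRel b (X lam) ψ (Fintype.card F ^ n)) (z (lam, ⟨g, hg⟩)) =
            Quot.mk _ (z (lam, ⟨g', hg'⟩)) := by
          simpa using h
        rw [(xmRel_equiv _).quot_mk_eq_iff] at h4
        obtain ⟨h, hh, h5⟩ := h4
        have h6 : ∀ v, Q (g' v) = Q (g (h v)) := fun v => h5 v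
        refine ⟨g.symm.trans (h.symm.trans g'), fun v => ?_, ?_⟩
        · simp [h6]
        · ext v
          show g' (X lam (g'.symm v)) = g' (h.symm (g.symm (g (X lam (g.symm (g (h (g'.symm v))))))))
          simp only [LinearEquiv.symm_apply_apply]
          rw [← hh.2, LinearEquiv.symm_apply_apply]
  have : ∀ lam : Shape n n, Finite (Quot (xmRel b (X lam) ψ (Fintype.card F ^ n))) := fun lam => Quot.finite _
  rw [hcard, Nat.card_sigma, Finset.mul_sum, ← Finset.sum_add_distrib]
  apply Finset.sum_congr rfl
  intro lam _
  exact count_shape hψ hb hdim QT (hX lam) lam (hJ lam)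
end


def Shape.toPart {n k : ℕ} (lam : Shape n k) : Nat.Partition k :=
  Nat.Partition.ofSums k (Multiset.map lam.1 (range n).val) lam.2.2.2

theorem Shape.toPart_inj {n k : ℕ} : Function.Injective (Shape.toPart : Shape n k → Nat.Partition k) := by
  have key : ∀ (lam : Shape n k) (j : ℕ), ∑ i ∈ range n, (lam.1 i - j) =
      (lam.toPart.parts.map (fun m => m - j)).sum := by
    intro lam j
    have h0 : ∀ s : Multiset ℕ, (s.map (fun m => m - j)).sum =
        ((s.filter (· ≠ 0)).map (fun m => m - j)).sum := by
      intro s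
      induction s using Multiset.induction_on with
      | empty => simp
      | cons a s ih =>
        by_cases ha : a = 0
        · rw [Multiset.filter_cons_of_neg _ (by simpa using ha), ← ih]
          simp [ha]
        · rw [Multiset.filter_cons_of_pos (p := (· ≠ 0)) _ ha]
          simp [ih]
    have : ∑ i ∈ range n, (lam.1 i - j) =
        ((Multiset.map lam.1 (range n).val).map (fun m => m - j)).sum := by
      rw [Multiset.map_map]; rfl
    rw [this, h0]
    rfl
  intro lam mu h
  apply Subtype.ext
  apply antitone_eq_of_sums lam.2.1 mu.2.1 lam.2.2.1 mu.2.2.1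
  intro j
  rw [key, key, h]

theorem Shape.toPart_surj {n k : ℕ} (hk : k ≤ n) :
    Function.Surjective (Shape.toPart : Shape n k → Nat.Partition k) := by
  intro p
  let l := p.parts.sort (· ≥ ·)
  have hl : (l : Multiset ℕ) = p.parts := Multiset.sort_eq _ _
  have hls : l.Pairwise (· ≥ ·) := Multiset.pairwise_sort _ _
  have hsum : l.sum = k := by
    rw [← Multiset.sum_coe, hl, p.parts_sum]
  have hpos : ∀ a ∈ l, 0 < a := by
    intro a ha
    apply p.parts_pos
    rw [← hl]; exact ha
  have hlen : l.length ≤ n := by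
    have := List.length_le_sum_of_one_le l hpos
    omega
  have hmap : (List.range n).map (fun i => l.getD i 0) = l ++ List.replicate (n - l.length) 0 := by
    apply List.ext_getElem
    · simp; omega
    · intro i h1 h2
      rw [List.getElem_map, List.getElem_range, List.getElem_append]
      split_ifs with h
      · rw [List.getD_eq_getElem _ _ h]
      · rw [List.getD_eq_default _ _ (by omega)]
        simp
  have hms : Multiset.map (fun i => l.getD i 0) (range n).val =
      (l : Multiset ℕ) + Multiset.replicate (n - l.length) 0 := by
    have : ((range n).val : Multiset ℕ) = ((List.range n : List ℕ) : Multiset ℕ) := rfl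
    rw [this, Multiset.map_coe, hmap, ← Multiset.coe_add, Multiset.coe_replicate]
  refine ⟨⟨fun i => l.getD i 0, ?_, ?_, ?_⟩, ?_⟩
  · intro i j hij
    dsimp only
    by_cases hj : j < l.length
    · rw [List.getD_eq_getElem _ _ hj, List.getD_eq_getElem _ _ (by omega)]
      rcases hij.eq_or_lt with rfl | hlt
      · exact le_refl _
      · exact List.pairwise_iff_getElem.1 hls i j (by omega) hj hlt
    · rw [List.getD_eq_default _ _ (by omega)]
      exact Nat.zero_le _
  · intro i hi
    exact List.getD_eq_default _ _ (by omega)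
  · rw [Finset.sum, hms]
    simp [hsum]
  · apply Nat.Partition.ext
    show Multiset.filter (· ≠ 0) (Multiset.map (fun i => l.getD i 0) (range n).val) = p.parts
    rw [hms, Multiset.filter_add, hl, Multiset.filter_eq_self.2, Multiset.filter_eq_nil.2, add_zero]
    · intro a ha
      rw [Multiset.eq_of_mem_replicate ha]; simp
    · intro a ha
      exact (p.parts_pos ha).ne'

theorem Shape.card {n k : ℕ} (hk : k ≤ n) : Nat.card (Shape n k) = numPartitions k := by
  rw [Nat.card_congr (Equiv.ofBijective _ ⟨Shape.toPart_inj, Shape.toPart_surj hk⟩)]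
  exact Nat.card_eq_fintype_card

theorem Shape.finite (n k : ℕ) : Finite (Shape n k) := Finite.of_injective _ Shape.toPart_inj

abbrev Wpair (n : ℕ) : Type := {p : (ℕ → ℕ) × (ℕ → ℕ) // Antitone p.1 ∧ (∀ i, n ≤ i → p.1 i = 0) ∧
  Antitone p.2 ∧ (∀ i, n ≤ i → p.2 i = 0) ∧ ∑ i ∈ range n, p.1 i + ∑ i ∈ range n, p.2 i = n}

theorem card_pairs1 (n : ℕ) [Fintype (Shape n n)] :
    ∑ lam : Shape n n, Nat.card (Aset lam.1) = Nat.card (Wpair n) := by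
  have : ∀ lam : Shape n n, Finite (Aset lam.1) := fun lam => Aset.finite lam.2.2.1
  rw [← Nat.card_sigma]
  apply Nat.card_congr
  refine Equiv.ofBijective (fun s => ⟨(s.2.1, fun i => s.1.1 i - s.2.1 i), s.2.2.1, ?_, s.2.2.2.2, ?_, ?_⟩) ⟨?_, ?_⟩
  · intro i hi
    have h1 := s.2.2.2.1 i
    have h2 := s.1.2.2.1 i hi
    show s.2.1 i = 0
    omega
  · intro i hi
    have h2 := s.1.2.2.1 i hi
    show s.1.1 i - s.2.1 i = 0
    omega
  · rw [← Finset.sum_add_distrib]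
    conv_rhs => rw [← s.1.2.2.2]
    apply Finset.sum_congr rfl
    intro i _
    exact Nat.add_sub_cancel' (s.2.2.2.1 i)
  · rintro ⟨lam, a⟩ ⟨mu, c⟩ h
    have h0 := congrArg Subtype.val h
    have h1 : a.1 = c.1 := congrArg Prod.fst h0
    have h2 : (fun i => lam.1 i - a.1 i) = fun i => mu.1 i - c.1 i := congrArg Prod.snd h0
    have h3 : lam = mu := by
      apply Subtype.ext
      funext i
      have e1 := congrFun h1 i
      have e2 : lam.1 i - a.1 i = mu.1 i - c.1 i := congrFun h2 i
      have e3 := a.2.2.1 i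
      have e4 := c.2.2.1 i
      omega
    subst h3
    rw [Subtype.ext h1]
  · rintro ⟨⟨α, β⟩, h1, h2, h3, h4, h5⟩
    dsimp only at h1 h2 h3 h4 h5
    have hsub : (fun i => α i + β i - α i) = β := by funext i; omega
    refine ⟨⟨⟨fun i => α i + β i, ?_, ?_, ?_⟩, ⟨α, h1, ?_, ?_⟩⟩, ?_⟩
    · exact fun i j h => Nat.add_le_add (h1 h) (h3 h)
    · intro i hi; dsimp only; rw [h2 i hi, h4 i hi]
    · rw [Finset.sum_add_distrib, h5]
    · intro i; exact Nat.le_add_right _ _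
    · dsimp only; rw [hsub]; exact h3
    · apply Subtype.ext
      dsimp only
      rw [hsub]

theorem card_pairs2 (n : ℕ) : Nat.card (Wpair n) = numPartitionPairs n := by
  have hf := Shape.finite
  have : Nat.card (Wpair n) = Nat.card (Σ k : Fin (n + 1), Shape n k × Shape n (n - k)) := by
    symm
    apply Nat.card_congr
    refine Equiv.ofBijective (fun s => ⟨(s.2.1.1, s.2.2.1), s.2.1.2.1, s.2.1.2.2.1, s.2.2.2.1, s.2.2.2.2.1, ?_⟩) ⟨?_, ?_⟩
    · have h1 := s.2.1.2.2.2
      have h2 := s.2.2.2.2.2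
      have := s.1.2
      dsimp only
      rw [h1, h2]; omega
    · rintro ⟨k, α, β⟩ ⟨k', α', β'⟩ h
      have h0 := congrArg Subtype.val h
      have h1 : α.1 = α'.1 := congrArg Prod.fst h0
      have h2 : β.1 = β'.1 := congrArg Prod.snd h0
      have h3 : k = k' := by
        apply Fin.ext
        rw [← α.2.2.2, ← α'.2.2.2, h1]
      subst h3
      rw [Subtype.ext h1, Subtype.ext h2]
    · rintro ⟨⟨α, β⟩, h1, h2, h3, h4, h5⟩
      dsimp only at h1 h2 h3 h4 h5
      refine ⟨⟨⟨∑ i ∈ range n, α i, by omega⟩, ⟨α, h1, h2, rfl⟩, ⟨β, h3, h4, ?_⟩⟩, rfl⟩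
      dsimp only
      omega
  rw [this, Nat.card_sigma, numPartitionPairs]
  rw [← Fin.sum_univ_eq_sum_range (fun k => numPartitions k * numPartitions (n - k))]
  apply Finset.sum_congr rfl
  intro k _
  have := k.2
  rw [Nat.card_prod, Shape.card (by omega), Shape.card (by omega)]

theorem card_fixed (n : ℕ) [Fintype (Shape n n)] :
    ∑ lam : Shape n n, Nat.card {a : Aset lam.1 // a.sig = a} =
      Nat.card {α : ℕ → ℕ // Antitone α ∧ (∀ i, n ≤ i → α i = 0) ∧ 2 * ∑ i ∈ range n, α i = n} := by
  have : ∀ lam : Shape n n, Finite (Aset lam.1) := fun lam => Aset.finite lam.2.2.1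
  rw [← Nat.card_sigma]
  apply Nat.card_congr
  have hkey : ∀ (lam : Shape n n) (a : {a : Aset lam.1 // a.sig = a}) i, lam.1 i = 2 * a.1.1 i := by
    intro lam a i
    have h1 : lam.1 i - a.1.1 i = a.1.1 i := congrFun (congrArg Subtype.val a.2) i
    have h2 := a.1.2.2.1 i
    omega
  refine Equiv.ofBijective (fun s => ⟨s.2.1.1, s.2.1.2.1, ?_, ?_⟩) ⟨?_, ?_⟩
  · intro i hi
    have h1 := hkey s.1 s.2 i
    have h2 := s.1.2.2.1 i hi
    omega
  · rw [Finset.mul_sum]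
    conv_rhs => rw [← s.1.2.2.2]
    apply Finset.sum_congr rfl
    intro i _
    exact (hkey s.1 s.2 i).symm
  · rintro ⟨lam, a⟩ ⟨mu, c⟩ h
    have h1 : a.1.1 = c.1.1 := congrArg Subtype.val h
    have h3 : lam = mu := by
      apply Subtype.ext
      funext i
      rw [hkey lam a, hkey mu c, h1]
    subst h3
    rw [Subtype.ext (Subtype.ext h1)]
  · rintro ⟨α, h1, h2, h3⟩
    have hsub : (fun i => 2 * α i - α i) = α := by funext i; omega
    refine ⟨⟨⟨fun i => 2 * α i, ?_, ?_, ?_⟩, ⟨⟨α, h1, ?_, ?_⟩, ?_⟩⟩, rfl⟩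
    · exact fun i j h => Nat.mul_le_mul_left 2 (h1 h)
    · intro i hi; dsimp only; rw [h2 i hi]
    · rw [← Finset.mul_sum, h3]
    · intro i; dsimp only; omega
    · dsimp only; rw [hsub]; exact h1
    · exact Subtype.ext hsub

theorem card_fixed_odd {n : ℕ} (hn : Odd n) :
    Nat.card {α : ℕ → ℕ // Antitone α ∧ (∀ i, n ≤ i → α i = 0) ∧ 2 * ∑ i ∈ range n, α i = n} = 0 := by
  have : IsEmpty {α : ℕ → ℕ // Antitone α ∧ (∀ i, n ≤ i → α i = 0) ∧ 2 * ∑ i ∈ range n, α i = n} := by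
    constructor
    rintro ⟨α, -, -, h⟩
    obtain ⟨m, hm⟩ := hn
    omega
  exact Nat.card_of_isEmpty

theorem card_fixed_even {n : ℕ} (hn : Even n) :
    Nat.card {α : ℕ → ℕ // Antitone α ∧ (∀ i, n ≤ i → α i = 0) ∧ 2 * ∑ i ∈ range n, α i = n} =
      numPartitions (n / 2) := by
  rw [← Shape.card (n := n) (k := n / 2) (Nat.div_le_self _ _)]
  apply Nat.card_congr
  apply Equiv.subtypeEquivRight
  intro α
  obtain ⟨m, hm⟩ := hn
  have : 2 * ∑ i ∈ range n, α i = n ↔ ∑ i ∈ range n, α i = n / 2 := by omega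
  rw [this]

/-- Over a finite field `F` of characteristic 2, the number of nilpotent
`O^-_{2n}(F)`-orbits in `𝔬^-_{2n}(F)` is `(1/2)p₂(n)` if `n` is odd, and
`(1/2)(p₂(n) - p(n/2))` if `n` is even.  Here `V^-` is the non-degenerate quadratic
space of dimension `2n` whose form has Witt index `n - 1`. -/
theorem nilpotent_orbits_even_orthogonal_minus
    (F : Type*) [Field F] [Fintype F] [CharP F 2]
    (n : ℕ) (hn : 1 ≤ n)
    (V : Type*) [AddCommGroup V] [Module F V] [FiniteDimensional F V]
    (Q : QuadraticForm F V)
    (hdim : Module.finrank F V = 2 * n)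
    (hQ : Q.IsNondegenerateFormSpace)
    (hWitt : Q.HasTotallySingularSubspace (n - 1))
    (hWitt' : ¬ Q.HasTotallySingularSubspace n) :
    (Odd n → 2 * Q.numNilpotentOOrbits = numPartitionPairs n) ∧
    (Even n → 2 * Q.numNilpotentOOrbits + numPartitions (n / 2) = numPartitionPairs n) := by
  classical
  have : Finite V := Module.finite_of_finite F
  have : Fintype V := Fintype.ofFinite V
  have : Finite (Shape n n) := Shape.finite n n
  have : Fintype (Shape n n) := Fintype.ofFinite _
  have h := orbits_sum n hn Q hdim hQ hWitt hWitt'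
  rw [card_fixed, card_pairs1, card_pairs2] at h
  constructor
  · intro ho
    rw [card_fixed_odd ho] at h
    exact h
  · intro he
    rw [card_fixed_even he] at h
    exact h
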